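/- Let p > 17 be a prime and consider the EAB code with row groups {0,1,2,3,4}. The number of (6,8) absorbing sets of the double-(4,8) configuration (two overlapping (4,8) absorbing sets sharing two variable nodes, where two variable nodes have 5 satisfied checks each) is exactly p²(p-1). -/

import Mathlib

open Finset

/-- Degree of check node `c` within the variable-node set `S` (neighborhoods given by `N`). -/
def chkDeg {V C : Type*} [DecidableEq C] (N : V → Finset C) (S : Finset V) (c : C) : ℕ :=
  (S.filter fun v => c ∈ N v).card

/-- The unsatisfied (odd-degree) neighboring check nodes of the set `S`. -/
def oddChecks {V C : Type*} [DecidableEq C] (N : V → Finset C) (S : Finset V) : Finset C :=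
  (S.biUnion N).filter fun c => chkDeg N S c % 2 = 1

/-- `S` is an absorbing set: each of its variable nodes has strictly fewer odd-degree
(unsatisfied) than even-degree (satisfied) neighboring check nodes. -/
def isAbsorbing {V C : Type*} [DecidableEq C] (N : V → Finset C) (S : Finset V) : Prop :=
  ∀ v ∈ S, ((N v).filter fun c => chkDeg N S c % 2 = 1).card <
    ((N v).filter fun c => chkDeg N S c % 2 = 0).card

/-- Every pair of distinct variable nodes of `T` shares a common check node. -/
def pairConn {V C : Type*} (N : V → Finset C) (T : Finset V) : Prop :=
  ∀ v ∈ T, ∀ w ∈ T, v ≠ w → ∃ c, c ∈ N v ∧ c ∈ N w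

/-- Neighboring check nodes in the elementary array-based (EAB) code with `r = 5`:
variable node `(j,k)` is adjacent to check node `(i,l)` iff `k + i·j = l (mod p)`. -/
def eabN (p : ℕ) [NeZero p] (v : ZMod p × ZMod p) : Finset (Fin 5 × ZMod p) :=
  Finset.univ.filter fun c => v.2 + ((c.1 : ℕ) : ZMod p) * v.1 = c.2

/-- Candidate points seen from both ends of the base segment, for each base direction. -/
def qPts : ℕ → List (ℕ × ℕ)
  | 0 => [(6288, 5712), (6216, 5784), (6192, 5808), (5856, 6288), (6432, 5136), (6288, 5424), (5928, 6216), (5712, 6864), (6576, 4272), (5952, 6192), (5856, 6576), (5568, 7728)]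
  | 1 => [(6072, 6000), (6096, 6000), (6108, 6000), (6072, 5856), (6288, 5424), (6216, 5568), (6048, 5856), (5856, 6432), (6432, 4704), (6036, 5856), (5928, 6288), (5712, 7152)]
  | 2 => [(5856, 6000), (6048, 6000), (6072, 6000), (6288, 5712), (6072, 5928), (6096, 5904), (6096, 5712), (6072, 5784), (6288, 5136), (6072, 5712), (6048, 5808), (5856, 6576)]
  | 3 => [(5712, 6000), (5928, 6000), (6036, 6000), (6432, 5568), (5856, 6144), (6048, 5952), (6216, 5568), (6288, 5424), (6072, 5856), (6108, 5568), (6096, 5616), (6072, 5712)]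
  | 4 => [(5568, 6000), (5856, 6000), (5952, 6000), (6576, 5424), (5712, 6288), (5928, 6072), (6288, 5424), (6432, 5136), (5856, 6288), (6192, 5424), (6216, 5352), (6288, 5136)]
  | _ => []

/-- Candidate points on the base line. -/
def lPts : ℕ → List (ℕ × ℕ)
  | 0 => [(4848, 6000), (5568, 6000), (5712, 6000), (5928, 6000), (5952, 6000), (5982, 6000), (6016, 6000), (6036, 6000), (6048, 6000), (6096, 6000), (6108, 6000), (6128, 6000), (6162, 6000), (6192, 6000), (6216, 6000), (6432, 6000), (6576, 6000), (7296, 6000)]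
  | 1 => [(4848, 7152), (5568, 6432), (5712, 6288), (5928, 6072), (5952, 6048), (5982, 6018), (6016, 5984), (6036, 5964), (6048, 5952), (6096, 5904), (6108, 5892), (6128, 5872), (6162, 5838), (6192, 5808), (6216, 5784), (6432, 5568), (6576, 5424), (7296, 4704)]
  | 2 => [(5568, 6864), (5712, 6576), (5928, 6144), (5952, 6096), (6036, 5928), (6048, 5904), (6096, 5808), (6108, 5784), (6192, 5616), (6216, 5568), (6432, 5136), (6576, 4848)]
  | 3 => [(4848, 9456), (5568, 7296), (5712, 6864), (5928, 6216), (5952, 6144), (5982, 6054), (6016, 5952), (6036, 5892), (6048, 5856), (6096, 5712), (6108, 5676), (6128, 5616), (6162, 5514), (6192, 5424), (6216, 5352), (6432, 4704), (6576, 4272), (7296, 2112)]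
  | 4 => [(4848, 10608), (5568, 7728), (5712, 7152), (5928, 6288), (5952, 6192), (5982, 6072), (6016, 5936), (6036, 5856), (6048, 5808), (6096, 5616), (6108, 5568), (6128, 5488), (6162, 5352), (6192, 5232), (6216, 5136), (6432, 4272), (6576, 3696), (7296, 816)]
  | _ => []

/-- Number of distinct odd classes (weighted walk along the list). -/
def odAux {α : Type*} (e : α → α → Bool) (S : List α) : List α → ℕ
  | [] => 0
  | x :: xs => Nat.add (bif xs.any (e x) then 0 else Nat.mod (S.countP (e x)) 2) (odAux e S xs)

/-- Sum over the five row groups. -/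
def sum5 (f : ℕ → ℕ) : ℕ := Nat.add (Nat.add (Nat.add (Nat.add (f 0) (f 1)) (f 2)) (f 3)) (f 4)

/-- Boolean test: absorbing, with eight unsatisfied checks. -/
def goodPts {α : Type*} (e : ℕ → α → α → Bool) (S : List α) : Bool :=
  S.all (fun v => Nat.ble (sum5 fun i => Nat.mod (S.countP (e i v)) 2) 2) &&
    Nat.beq (sum5 fun i => odAux (e i) S S) 8

/-- Line label of a natural point. -/
def labN (i : ℕ) (P : ℕ × ℕ) : ℕ := Nat.add P.2 (Nat.mul i P.1)

/-- Equality of line labels modulo `q` (`q = 0`: exact equality). -/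
def eN (q i : ℕ) (P R : ℕ × ℕ) : Bool := Nat.beq (Nat.mod (labN i P) q) (Nat.mod (labN i R) q)

def sameN (q : ℕ) (P R : ℕ × ℕ) : Bool := eN q 0 P R && eN q 1 P R

def connN (q : ℕ) (P R : ℕ × ℕ) : Bool :=
  eN q 0 P R || eN q 1 P R || eN q 2 P R || eN q 3 P R || eN q 4 P R

def keyLe (P R : ℕ × ℕ) : Bool := Nat.ble (labN 20000 P) (labN 20000 R)

def ptA : ℕ × ℕ := (6000, 6000)

def ptB : ℕ → ℕ × ℕ
  | 0 => (6144, 6000)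
  | 1 => (6144, 5856)
  | 2 => (6144, 5712)
  | 3 => (6144, 5568)
  | _ => (6144, 5424)

def shapeA : List (ℕ × ℕ) := [(5856, 6000), (6288, 5136), (6288, 5712), (5856, 6576)]

def shapeB : List (ℕ × ℕ) := [(6048, 6000), (6096, 5904), (6096, 5712), (6048, 5808)]

def memN (l : List (ℕ × ℕ)) (P : ℕ × ℕ) : Bool :=
  l.any fun R => Nat.beq P.1 R.1 && Nat.beq P.2 R.2

/-- Search: no candidate lies on the base line. -/
def searchI (q m : ℕ) : Bool :=
  (qPts m).all fun C => (qPts m).all fun D => !(keyLe C D) || !(connN q C D) || sameN q C D ||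
    (qPts m).all fun E => !(keyLe C E) || sameN q C E || sameN q D E ||
      (qPts m).all fun F => !(keyLe E F) || !(connN q E F) || sameN q C F || sameN q D F ||
      sameN q E F ||
      !(goodPts (eN q) [C, D, E, F, ptA, ptB m]) || (Nat.beq m 2 &&
        ([C, D, E, F].all (memN shapeA) || [C, D, E, F].all (memN shapeB)))

/-- Search: exactly one candidate `C` lies on the base line. -/
def searchII (q m : ℕ) : Bool :=
  (lPts m).all fun C => (qPts m).all fun D => !(connN q C D) ||
    (qPts m).all fun E => !(connN q C E) || sameN q D E ||
      (qPts m).all fun F => !(connN q C F) || sameN q D F || sameN q E F ||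
      !(goodPts (eN q) [C, D, E, F, ptA, ptB m])

/-- Search: exactly two candidates `C`, `D` lie on the base line. -/
def searchIII (q m : ℕ) : Bool :=
  (lPts m).all fun C => (qPts m).all fun E => !(connN q C E) ||
    (qPts m).all fun F => !(connN q C F) || sameN q E F ||
      (lPts m).all fun D => !(connN q D E) || !(connN q D F) || sameN q C D ||
      !(goodPts (eN q) [C, D, E, F, ptA, ptB m])

/-- The difference of the two numbers is zero or has only prime factors in the list. -/
def smN (x y : ℕ) : Bool :=
  Nat.beq x y || Nat.beq (Nat.mod (Nat.pow 16285779510 13) (Nat.add (Nat.sub x y) (Nat.sub y x))) 0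

def allPts (m : ℕ) : List (ℕ × ℕ) := ptA :: ptB m :: (qPts m ++ lPts m)

def smCheck (m : ℕ) : Bool :=
  (allPts m).all fun P => (allPts m).all fun R =>
    smN (labN 0 P) (labN 0 R) && smN (labN 1 P) (labN 1 R) && smN (labN 2 P) (labN 2 R) &&
      smN (labN 3 P) (labN 3 R) && smN (labN 4 P) (labN 4 R)

theorem smCheck_true : ∀ m < 5, smCheck m = true := by decide +kernel

theorem searchI_true : ∀ q ∈ [0, 19, 23, 73], ∀ m < 5, searchI q m = true := by decide +kernel

theorem searchII_true : ∀ q ∈ [0, 19, 23, 73], ∀ m < 5, searchII q m = true := by decide +kernel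

theorem searchIII_true : ∀ q ∈ [0, 19, 23, 73], ∀ m < 5, searchIII q m = true := by decide +kernel

/-- Line label of a variable node in row group `i`. -/
def lab {p : ℕ} (i : ℕ) (v : ZMod p × ZMod p) : ZMod p := v.2 + (i : ZMod p) * v.1

def eF {p : ℕ} (i : ℕ) (v u : ZMod p × ZMod p) : Bool := decide (lab i v = lab i u)

lemma mem_eabN {p : ℕ} [NeZero p] (v : ZMod p × ZMod p) (c : Fin 5 × ZMod p) :
    c ∈ eabN p v ↔ lab c.1 v = c.2 := by
  simp [eabN, lab]

lemma chkDeg_eq {p : ℕ} [NeZero p] (S : List (ZMod p × ZMod p)) (hS : S.Nodup)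
    (c : Fin 5 × ZMod p) :
    chkDeg (eabN p) S.toFinset c = S.countP (fun u => decide (c.2 = lab c.1 u)) := by
  unfold chkDeg
  have : (S.toFinset.filter fun v => c ∈ eabN p v)
      = (S.filter (fun u => decide (c.2 = lab c.1 u))).toFinset := by
    ext v
    simp [mem_eabN, eq_comm]
  rw [this, List.toFinset_card_of_nodup (hS.filter _), List.countP_eq_length_filter]

lemma eabN_eq {p : ℕ} [NeZero p] (v : ZMod p × ZMod p) :
    eabN p v = (Finset.univ : Finset (Fin 5)).image (fun i : Fin 5 => (i, lab (i : ℕ) v)) := by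
  ext ⟨i, l⟩
  simp [mem_eabN]

lemma card_filter_eabN {p : ℕ} [NeZero p] (v : ZMod p × ZMod p)
    (P : Fin 5 × ZMod p → Prop) [DecidablePred P] :
    ((eabN p v).filter P).card = ∑ i : Fin 5, if P (i, lab (i : ℕ) v) then 1 else 0 := by
  rw [eabN_eq, Finset.filter_image, Finset.card_image_of_injective, Finset.card_filter]
  intro a b h
  exact (Prod.ext_iff.1 h).1

lemma absorbing_iff {p : ℕ} [NeZero p] (S : List (ZMod p × ZMod p)) (hS : S.Nodup) :
    isAbsorbing (eabN p) S.toFinset ↔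
      ∀ v ∈ S, sum5 (fun i => (S.countP (eF i v)) % 2) ≤ 2 := by
  unfold isAbsorbing
  simp only [List.mem_toFinset]
  refine forall₂_congr fun v _ => ?_
  rw [card_filter_eabN, card_filter_eabN]
  simp only [chkDeg_eq S hS, Fin.sum_univ_five]
  change _ ↔ (S.countP (eF 0 v)) % 2 + (S.countP (eF 1 v)) % 2 + (S.countP (eF 2 v)) % 2
    + (S.countP (eF 3 v)) % 2 + (S.countP (eF 4 v)) % 2 ≤ 2
  have e : ∀ i : Fin 5, (S.countP (fun u => decide (lab (i : ℕ) v = lab (i : ℕ) u)))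
    = S.countP (eF (i : ℕ) v) := fun i => rfl
  simp only [e]
  simp only [show ((0 : Fin 5) : ℕ) = 0 from rfl, show ((1 : Fin 5) : ℕ) = 1 from rfl,
    show ((2 : Fin 5) : ℕ) = 2 from rfl, show ((3 : Fin 5) : ℕ) = 3 from rfl,
    show ((4 : Fin 5) : ℕ) = 4 from rfl]
  have key : ∀ n : ℕ, ((if n % 2 = 1 then 1 else 0) = n % 2) ∧
      ((if n % 2 = 0 then 1 else 0) = 1 - n % 2) := by
    intro n
    constructor <;> split_ifs <;> omega
  simp only [key]
  omega

lemma odAux_eq {p : ℕ} (i : ℕ) (S l : List (ZMod p × ZMod p)) :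
    odAux (eF i) S l = ((l.map (lab i)).toFinset.filter
      (fun t => S.countP (fun u => decide (t = lab i u)) % 2 = 1)).card := by
  induction l with
  | nil => simp [odAux]
  | cons x xs ih =>
    have h : odAux (eF i) S (x :: xs) =
      (bif xs.any (eF i x) then 0 else (S.countP (eF i x)) % 2) + odAux (eF i) S xs := rfl
    rw [h, ih, List.map_cons, List.toFinset_cons]
    by_cases hx : lab i x ∈ (xs.map (lab i)).toFinset
    · rw [Finset.insert_eq_of_mem hx]
      have : xs.any (eF i x) = true := by
        simp only [List.mem_toFinset, List.mem_map] at hx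
        obtain ⟨a, ha, hh⟩ := hx
        exact List.any_eq_true.2 ⟨a, ha, by simp [eF, hh]⟩
      simp [this]
    · have : xs.any (eF i x) = false := by
        rw [List.any_eq_false]
        intro a ha hh
        apply hx
        simp only [List.mem_toFinset, List.mem_map]
        exact ⟨a, ha, by simpa [eF, eq_comm] using hh⟩
      rw [this, Finset.filter_insert]
      have e : S.countP (fun u => decide (lab i x = lab i u)) = S.countP (eF i x) := rfl
      rw [e]
      split_ifs with h1
      · rw [Finset.card_insert_of_notMem (by simp only [Finset.mem_filter]; tauto)]
        simp only [cond_false]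
        omega
      · simp only [cond_false]
        omega

lemma oddChecks_card {p : ℕ} [NeZero p] (S : List (ZMod p × ZMod p)) (hS : S.Nodup) :
    (oddChecks (eabN p) S.toFinset).card = sum5 (fun i => odAux (eF i) S S) := by
  have h1 : (oddChecks (eabN p) S.toFinset).card =
      ∑ i : Fin 5, ((oddChecks (eabN p) S.toFinset).filter (fun c => c.1 = i)).card :=
    Finset.card_eq_sum_card_fiberwise (fun _ _ => Finset.mem_coe.2 (Finset.mem_univ _))
  have h2 : ∀ i : Fin 5, ((oddChecks (eabN p) S.toFinset).filter (fun c => c.1 = i)).card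
      = odAux (eF (i : ℕ)) S S := by
    intro i
    rw [odAux_eq, ← Finset.card_image_of_injective (f := fun t : ZMod p => (i, t)) _
      (fun a b h => (Prod.ext_iff.1 h).2)]
    congr 1
    ext ⟨a, t⟩
    simp only [oddChecks, Finset.mem_filter, Finset.mem_biUnion, List.mem_toFinset, mem_eabN,
      chkDeg_eq S hS, Finset.mem_image, List.mem_map, Prod.mk.injEq]
    constructor
    · rintro ⟨⟨h, h'⟩, rfl⟩
      exact ⟨t, ⟨h, h'⟩, rfl, rfl⟩
    · rintro ⟨t', ⟨h, h'⟩, rfl, rfl⟩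
      exact ⟨⟨h, h'⟩, rfl⟩
  rw [h1, Fin.sum_univ_five]
  simp only [h2]
  rfl

lemma good_iff {p : ℕ} [NeZero p] (S : List (ZMod p × ZMod p)) (hS : S.Nodup) :
    (isAbsorbing (eabN p) S.toFinset ∧ (oddChecks (eabN p) S.toFinset).card = 8) ↔
      goodPts eF S = true := by
  rw [absorbing_iff S hS, oddChecks_card S hS]
  unfold goodPts
  rw [Bool.and_eq_true, List.all_eq_true]
  simp only [Nat.ble_eq, Nat.beq_eq]
  rfl

lemma odAux_map {α β : Type*} (f : α → β) (e : β → β → Bool) (e' : α → α → Bool) (S : List α)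
    (h : ∀ x ∈ S, ∀ y ∈ S, e (f x) (f y) = e' x y) (l : List α) (hl : ∀ x ∈ l, x ∈ S) :
    odAux e (S.map f) (l.map f) = odAux e' S l := by
  induction l with
  | nil => rfl
  | cons x xs ih =>
    have hx : x ∈ S := hl x (by simp)
    have hxs : ∀ y ∈ xs, y ∈ S := fun y hy => hl y (by simp [hy])
    have h1 : (S.map f).countP (e (f x)) = S.countP (e' x) := by
      rw [List.countP_map]
      exact List.countP_congr fun y hy => by simp [h x hx y hy]
    have h2 : (xs.map f).any (e (f x)) = xs.any (e' x) := by
      rw [Bool.eq_iff_iff]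
      simp only [List.any_map, List.any_eq_true, Function.comp]
      exact exists_congr fun y => and_congr_right fun hy => by rw [h x hx y (hxs y hy)]
    have := ih hxs
    simp only [List.map_cons, odAux, h1, h2, this]

lemma goodPts_map {α β : Type*} (f : α → β) (e : ℕ → β → β → Bool) (e' : ℕ → α → α → Bool)
    (S : List α) (h : ∀ i < 5, ∀ x ∈ S, ∀ y ∈ S, e i (f x) (f y) = e' i x y) :
    goodPts e (S.map f) = goodPts e' S := by
  have h1 : ∀ i < 5, ∀ x ∈ S, (S.map f).countP (e i (f x)) = S.countP (e' i x) := by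
    intro i hi x hx
    rw [List.countP_map]
    exact List.countP_congr fun y hy => by simp [h i hi x hx y hy]
  have h2 : ∀ i < 5, odAux (e i) (S.map f) (S.map f) = odAux (e' i) S S := fun i hi =>
    odAux_map f (e i) (e' i) S (h i hi) S (fun _ hx => hx)
  unfold goodPts sum5
  beta_reduce
  rw [h2 0 (by norm_num), h2 1 (by norm_num), h2 2 (by norm_num), h2 3 (by norm_num),
    h2 4 (by norm_num)]
  congr 1
  rw [Bool.eq_iff_iff, List.all_map, List.all_eq_true, List.all_eq_true]
  refine forall₂_congr fun x hx => ?_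
  simp only [Function.comp]
  rw [h1 0 (by norm_num) x hx, h1 1 (by norm_num) x hx, h1 2 (by norm_num) x hx,
    h1 3 (by norm_num) x hx, h1 4 (by norm_num) x hx]

/-- Affine placement of a natural point. -/
def place {p : ℕ} (O : ZMod p × ZMod p) (w : ZMod p) (P : ℕ × ℕ) : ZMod p × ZMod p :=
  (O.1 + w * (P.1 : ZMod p), O.2 + w * (P.2 : ZMod p))

lemma lab_place {p : ℕ} (O : ZMod p × ZMod p) (w : ZMod p) (i : ℕ) (P : ℕ × ℕ) :
    lab i (place O w P) = lab i O + w * ((labN i P : ℕ) : ZMod p) := by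
  have : labN i P = P.2 + i * P.1 := rfl
  rw [this]
  simp only [lab, place]
  push_cast
  ring

/-- The modulus used in the finite search. -/
def qOf (p : ℕ) : ℕ := if p = 19 ∨ p = 23 ∨ p = 73 then p else 0

lemma qOf_mem (p : ℕ) : qOf p ∈ [0, 19, 23, 73] := by
  unfold qOf
  split_ifs with h
  · rcases h with rfl | rfl | rfl <;> simp
  · simp

lemma smN_exact {p : ℕ} [hp : Fact p.Prime] (hp17 : 17 < p) (x y : ℕ) (h : smN x y = true) :
    (x : ZMod p) = (y : ZMod p) ↔ x % (qOf p) = y % (qOf p) := by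
  unfold qOf
  split_ifs with hq
  · exact ZMod.natCast_eq_natCast_iff' x y p
  · rw [Nat.mod_zero, Nat.mod_zero]
    refine ⟨fun hxy => ?_, fun h => by rw [h]⟩
    by_contra hne
    unfold smN at h
    rw [Bool.or_eq_true, Nat.beq_eq, Nat.beq_eq] at h
    have h2 := h.resolve_left hne
    have h3 : ((x - y) + (y - x)) ∣ 16285779510 ^ 13 := Nat.dvd_of_mod_eq_zero h2
    have h4 : p ∣ (x - y) + (y - x) := by
      have := (ZMod.natCast_eq_natCast_iff x y p).1 hxy
      rcases le_total x y with hle | hle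
      · have h5 := (Nat.modEq_iff_dvd' hle).1 this
        rwa [Nat.sub_eq_zero_of_le hle, zero_add]
      · have h5 := (Nat.modEq_iff_dvd' hle).1 this.symm
        rwa [Nat.sub_eq_zero_of_le hle, add_zero]
    have h5 : p ∣ 16285779510 := hp.out.dvd_of_dvd_pow (h4.trans h3)
    have h6 : (16285779510 : ℕ) = 2 * 3 * 5 * 7 * 11 * 13 * 17 * 19 * 23 * 73 := by norm_num
    rw [h6] at h5
    have hP := hp.out
    simp only [hP.dvd_mul] at h5
    have big : ∀ n : ℕ, 0 < n → n ≤ 17 → ¬ p ∣ n := fun n h0 h1 hd =>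
      absurd (Nat.le_of_dvd h0 hd) (by omega)
    have eqp : ∀ n : ℕ, n.Prime → p ∣ n → p = n := fun n hn hd =>
      (Nat.prime_dvd_prime_iff_eq hP hn).1 hd
    rcases h5 with ((((((((h | h) | h) | h) | h) | h) | h) | h) | h) | h
    · exact big _ (by norm_num) (by norm_num) h
    · exact big _ (by norm_num) (by norm_num) h
    · exact big _ (by norm_num) (by norm_num) h
    · exact big _ (by norm_num) (by norm_num) h
    · exact big _ (by norm_num) (by norm_num) h
    · exact big _ (by norm_num) (by norm_num) h
    · exact big _ (by norm_num) (by norm_num) h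
    · exact hq (Or.inl (eqp _ (by norm_num) h))
    · exact hq (Or.inr (Or.inl (eqp _ (by norm_num) h)))
    · exact hq (Or.inr (Or.inr (eqp _ (by norm_num) h)))

lemma smCheck_spec (m : ℕ) (hm : m < 5) (P R : ℕ × ℕ) (hP : P ∈ allPts m) (hR : R ∈ allPts m)
    (i : ℕ) (hi : i < 5) : smN (labN i P) (labN i R) = true := by
  have h := smCheck_true m hm
  unfold smCheck at h
  rw [List.all_eq_true] at h
  have h := h P hP
  rw [List.all_eq_true] at h
  have h := h R hR
  simp only [Bool.and_eq_true] at h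
  obtain ⟨⟨⟨⟨h0, h1⟩, h2⟩, h3⟩, h4⟩ := h
  interval_cases i <;> assumption

lemma lab_place_iff {p : ℕ} [hp : Fact p.Prime] (hp17 : 17 < p) (m : ℕ) (hm : m < 5)
    (O : ZMod p × ZMod p) (w : ZMod p) (hw : w ≠ 0)
    (P R : ℕ × ℕ) (hP : P ∈ allPts m) (hR : R ∈ allPts m) (i : ℕ) (hi : i < 5) :
    lab i (place O w P) = lab i (place O w R) ↔ eN (qOf p) i P R = true := by
  rw [lab_place, lab_place, add_right_inj, mul_right_inj' hw,
    smN_exact hp17 _ _ (smCheck_spec m hm P R hP hR i hi)]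
  unfold eN
  rw [Nat.beq_eq]
  rfl

lemma eF_place {p : ℕ} [hp : Fact p.Prime] (hp17 : 17 < p) (m : ℕ) (hm : m < 5)
    (O : ZMod p × ZMod p) (w : ZMod p) (hw : w ≠ 0)
    (P R : ℕ × ℕ) (hP : P ∈ allPts m) (hR : R ∈ allPts m) (i : ℕ) (hi : i < 5) :
    eF i (place O w P) (place O w R) = eN (qOf p) i P R := by
  rw [Bool.eq_iff_iff, ← lab_place_iff hp17 m hm O w hw P R hP hR i hi]
  simp [eF]

lemma cast_ne {p : ℕ} [hp : Fact p.Prime] (hp17 : 17 < p) (a b : ℕ) (ha : a < 5) (hb : b < 5)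
    (hab : a ≠ b) : (a : ZMod p) ≠ (b : ZMod p) := by
  intro h
  rw [ZMod.natCast_eq_natCast_iff', Nat.mod_eq_of_lt (by omega), Nat.mod_eq_of_lt (by omega)] at h
  exact hab h

lemma eq_of_lab {p : ℕ} [hp : Fact p.Prime] (hp17 : 17 < p) (a b : ℕ) (ha : a < 5) (hb : b < 5)
    (hab : a ≠ b) (X Y : ZMod p × ZMod p) (h1 : lab a X = lab a Y) (h2 : lab b X = lab b Y) :
    X = Y := by
  have hne := sub_ne_zero.2 (cast_ne hp17 a b ha hb hab)
  unfold lab at h1 h2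
  have h3 : ((a : ZMod p) - b) * (X.1 - Y.1) = 0 := by linear_combination h1 - h2
  have h4 : X.1 = Y.1 := sub_eq_zero.1 ((mul_eq_zero.1 h3).resolve_left hne)
  refine Prod.ext h4 ?_
  rw [h4] at h1
  exact add_right_cancel h1

/-- Connection of variable nodes. -/
def conn {p : ℕ} (X Y : ZMod p × ZMod p) : Prop := ∃ i < 5, lab i X = lab i Y

lemma conn_symm {p : ℕ} {X Y : ZMod p × ZMod p} (h : conn X Y) : conn Y X := by
  obtain ⟨i, hi, h⟩ := h
  exact ⟨i, hi, h.symm⟩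

lemma place_same {p : ℕ} [hp : Fact p.Prime] (hp17 : 17 < p) (m : ℕ) (hm : m < 5)
    (O : ZMod p × ZMod p) (w : ZMod p) (hw : w ≠ 0)
    (P R : ℕ × ℕ) (hP : P ∈ allPts m) (hR : R ∈ allPts m) :
    place O w P = place O w R ↔ sameN (qOf p) P R = true := by
  unfold sameN
  rw [Bool.and_eq_true, ← lab_place_iff hp17 m hm O w hw P R hP hR 0 (by norm_num),
    ← lab_place_iff hp17 m hm O w hw P R hP hR 1 (by norm_num)]
  exact ⟨fun h => by rw [h]; exact ⟨rfl, rfl⟩, fun h =>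
    eq_of_lab hp17 0 1 (by norm_num) (by norm_num) (by norm_num) _ _ h.1 h.2⟩

lemma place_conn {p : ℕ} [hp : Fact p.Prime] (hp17 : 17 < p) (m : ℕ) (hm : m < 5)
    (O : ZMod p × ZMod p) (w : ZMod p) (hw : w ≠ 0)
    (P R : ℕ × ℕ) (hP : P ∈ allPts m) (hR : R ∈ allPts m) :
    conn (place O w P) (place O w R) ↔ connN (qOf p) P R = true := by
  unfold connN conn
  simp only [Bool.or_eq_true]
  constructor
  · rintro ⟨i, hi, h⟩
    have := (lab_place_iff hp17 m hm O w hw P R hP hR i hi).1 h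
    interval_cases i <;> tauto
  · intro h
    rcases h with (((h | h) | h) | h) | h
    · exact ⟨0, by norm_num, (lab_place_iff hp17 m hm O w hw P R hP hR _ (by norm_num)).2 h⟩
    · exact ⟨1, by norm_num, (lab_place_iff hp17 m hm O w hw P R hP hR _ (by norm_num)).2 h⟩
    · exact ⟨2, by norm_num, (lab_place_iff hp17 m hm O w hw P R hP hR _ (by norm_num)).2 h⟩
    · exact ⟨3, by norm_num, (lab_place_iff hp17 m hm O w hw P R hP hR _ (by norm_num)).2 h⟩
    · exact ⟨4, by norm_num, (lab_place_iff hp17 m hm O w hw P R hP hR _ (by norm_num)).2 h⟩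

lemma pairConn_iff {p : ℕ} [NeZero p] (T : Finset (ZMod p × ZMod p)) :
    pairConn (eabN p) T ↔ ∀ v ∈ T, ∀ u ∈ T, v ≠ u → conn v u := by
  unfold pairConn
  refine forall₂_congr fun v _ => forall₂_congr fun u _ => imp_congr_right fun _ => ?_
  constructor
  · rintro ⟨c, h1, h2⟩
    rw [mem_eabN] at h1 h2
    exact ⟨c.1, c.1.2, h1.trans h2.symm⟩
  · rintro ⟨i, hi, h⟩
    exact ⟨(⟨i, hi⟩, lab i v), (mem_eabN _ _).2 rfl, (mem_eabN _ _).2 h.symm⟩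

lemma table_q' : ∀ m a b : Fin 5, (a ≠ b ∧ a ≠ m ∧ b ≠ m) →
    ∃ P ∈ qPts m, labN a P = labN a ptA ∧ labN b P = labN b (ptB m) := by decide +kernel

lemma table_q (m : ℕ) (hm : m < 5) (a : ℕ) (ha : a < 5) (b : ℕ) (hb : b < 5)
    (h : a ≠ b ∧ a ≠ m ∧ b ≠ m) :
    ∃ P ∈ qPts m, labN a P = labN a ptA ∧ labN b P = labN b (ptB m) :=
  table_q' ⟨m, hm⟩ ⟨a, ha⟩ ⟨b, hb⟩ (by simpa [Fin.ext_iff] using h)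

lemma table_l : ∀ m < 5, ∀ P ∈ qPts m, ∀ c < 5, c ≠ m →
    ∃ R ∈ ptA :: ptB m :: lPts m, labN m R = labN m ptA ∧ labN c R = labN c P := by decide +kernel

lemma table_b : ∀ m < 5, labN m (ptB m) = labN m ptA ∧ (ptB m).1 = 6144 := by decide +kernel

lemma mem_all_q {m : ℕ} {P : ℕ × ℕ} (h : P ∈ qPts m) : P ∈ allPts m := by
  simp [allPts, h]

lemma mem_all_l {m : ℕ} {P : ℕ × ℕ} (h : P ∈ lPts m) : P ∈ allPts m := by
  simp [allPts, h]

lemma mem_all_a {m : ℕ} : ptA ∈ allPts m := by simp [allPts]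

lemma mem_all_b {m : ℕ} : ptB m ∈ allPts m := by simp [allPts]

lemma exists_base {p : ℕ} [hp : Fact p.Prime] (hp17 : 17 < p) (m : ℕ) (hm : m < 5)
    (A B : ZMod p × ZMod p) (hAB : A ≠ B) (h : lab m A = lab m B) :
    ∃ O w, w ≠ 0 ∧ A = place O w ptA ∧ B = place O w (ptB m) := by
  have h144 : (144 : ZMod p) ≠ 0 := by
    intro h0
    have h1 : ((144 : ℕ) : ZMod p) = 0 := by exact_mod_cast h0
    rw [ZMod.natCast_eq_zero_iff] at h1
    have h2 : p ∣ 2 ^ 4 * 3 ^ 2 := by simpa using h1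
    rcases (hp.out.dvd_mul).1 h2 with h3 | h3
    · have := Nat.le_of_dvd (by norm_num) (hp.out.dvd_of_dvd_pow h3); omega
    · have := Nat.le_of_dvd (by norm_num) (hp.out.dvd_of_dvd_pow h3); omega
  have hne : B.1 - A.1 ≠ 0 := by
    intro h0
    apply hAB
    have h1 : A.1 = B.1 := (sub_eq_zero.1 h0).symm
    refine Prod.ext h1 ?_
    unfold lab at h
    rw [h1] at h
    exact add_right_cancel h
  set w : ZMod p := (B.1 - A.1) / 144 with hw
  have hw' : w * 144 = B.1 - A.1 := div_mul_cancel₀ _ h144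
  have hA : A = place (A.1 - w * 6000, A.2 - w * 6000) w ptA := by
    refine Prod.ext ?_ ?_ <;> simp [place, ptA]
  refine ⟨(A.1 - w * 6000, A.2 - w * 6000), w, div_ne_zero hne h144, hA, ?_⟩
  obtain ⟨hb1, hb2⟩ := table_b m hm
  have e1 : B.1 = (place (A.1 - w * 6000, A.2 - w * 6000) w (ptB m)).1 := by
    simp only [place, hb2]
    push_cast
    linear_combination (-1 : ZMod p) * hw'
  have e2 : lab m B = lab m (place (A.1 - w * 6000, A.2 - w * 6000) w (ptB m)) := by
    rw [← h, lab_place, hb1, ← lab_place, ← hA]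
  refine Prod.ext e1 ?_
  unfold lab at e2
  rw [← e1] at e2
  exact add_right_cancel e2

lemma off_line {p : ℕ} [hp : Fact p.Prime] (hp17 : 17 < p) (m : ℕ) (hm : m < 5)
    (A B X O : ZMod p × ZMod p) (w : ZMod p) (hAB : A ≠ B)
    (hA : A = place O w ptA) (hB : B = place O w (ptB m))
    (hXA : conn X A) (hXB : conn X B) (hX : lab m X ≠ lab m A) :
    ∃ P ∈ qPts m, X = place O w P := by
  obtain ⟨a, ha, h1⟩ := hXA
  obtain ⟨b, hb, h2⟩ := hXB
  have hBA : lab m B = lab m A := by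
    rw [hA, hB, lab_place, lab_place, (table_b m hm).1]
  have ham : a ≠ m := by rintro rfl; exact hX h1
  have hbm : b ≠ m := by rintro rfl; exact hX (h2.trans hBA)
  have hab : a ≠ b := by
    rintro rfl
    exact hAB (eq_of_lab hp17 a m ha hm ham A B (h1.symm.trans h2) hBA.symm)
  obtain ⟨P, hP, e1, e2⟩ := table_q m hm a ha b hb ⟨hab, ham, hbm⟩
  refine ⟨P, hP, eq_of_lab hp17 a b ha hb hab _ _ ?_ ?_⟩
  · rw [h1, hA, lab_place, lab_place, e1]
  · rw [h2, hB, lab_place, lab_place, e2]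

lemma on_line {p : ℕ} [hp : Fact p.Prime] (hp17 : 17 < p) (m : ℕ) (hm : m < 5)
    (A B X Y O : ZMod p × ZMod p) (w : ZMod p)
    (hA : A = place O w ptA) (hB : B = place O w (ptB m))
    (hX : lab m X = lab m A) (hXA : X ≠ A) (hXB : X ≠ B) (hXY : conn X Y)
    (hY : lab m Y ≠ lab m A) (P : ℕ × ℕ) (hP : P ∈ qPts m) (hYP : Y = place O w P) :
    ∃ R ∈ lPts m, X = place O w R := by
  obtain ⟨c, hc, h⟩ := hXY
  have hcm : c ≠ m := by rintro rfl; exact hY (h.symm.trans hX)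
  obtain ⟨R, hR, e1, e2⟩ := table_l m hm P hP c hc hcm
  have hXR : X = place O w R := by
    refine eq_of_lab hp17 m c hm hc hcm.symm _ _ ?_ ?_
    · rw [hX, hA, lab_place, lab_place, e1]
    · rw [h, hYP, lab_place, lab_place, e2]
  rw [List.mem_cons, List.mem_cons] at hR
  rcases hR with rfl | rfl | hR
  · exact absurd (hXR.trans hA.symm) hXA
  · exact absurd (hXR.trans hB.symm) hXB
  · exact ⟨R, hR, hXR⟩

lemma three_even {p : ℕ} [NeZero p] (S : Finset (ZMod p × ZMod p))
    (hS : isAbsorbing (eabN p) S) (v : ZMod p × ZMod p) (hv : v ∈ S) (x y : ℕ) :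
    ∃ i : Fin 5, (i : ℕ) ≠ x ∧ (i : ℕ) ≠ y ∧
      chkDeg (eabN p) S (i, lab (i : ℕ) v) % 2 = 0 ∧
      ∃ u ∈ S, u ≠ v ∧ lab (i : ℕ) u = lab (i : ℕ) v := by
  have h := hS v hv
  rw [card_filter_eabN, card_filter_eabN] at h
  by_contra hcon
  push Not at hcon
  have key : ∀ i : Fin 5, chkDeg (eabN p) S (i, lab (i : ℕ) v) % 2 = 0 →
      (i : ℕ) = x ∨ (i : ℕ) = y := by
    intro i hi
    by_contra hne
    push Not at hne
    have hc := hcon i hne.1 hne.2 hi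
    have : chkDeg (eabN p) S (i, lab (i : ℕ) v) = 1 := by
      unfold chkDeg
      rw [Finset.card_eq_one]
      refine ⟨v, ?_⟩
      ext u
      simp only [Finset.mem_filter, mem_eabN, Finset.mem_singleton]
      constructor
      · rintro ⟨h1, h2⟩
        by_contra h3
        exact hc u h1 h3 h2
      · rintro rfl
        exact ⟨hv, rfl⟩
    omega
  have k0 := key 0
  have k1 := key 1
  have k2 := key 2
  have k3 := key 3
  have k4 := key 4
  simp only [Fin.sum_univ_five] at h
  simp only [show ((0 : Fin 5) : ℕ) = 0 from rfl, show ((1 : Fin 5) : ℕ) = 1 from rfl,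
    show ((2 : Fin 5) : ℕ) = 2 from rfl, show ((3 : Fin 5) : ℕ) = 3 from rfl,
    show ((4 : Fin 5) : ℕ) = 4 from rfl] at h k0 k1 k2 k3 k4
  generalize chkDeg (eabN p) S (0, lab 0 v) = d0 at *
  generalize chkDeg (eabN p) S (1, lab 1 v) = d1 at *
  generalize chkDeg (eabN p) S (2, lab 2 v) = d2 at *
  generalize chkDeg (eabN p) S (3, lab 3 v) = d3 at *
  generalize chkDeg (eabN p) S (4, lab 4 v) = d4 at *
  have e1 : ∀ n : ℕ, ((if n % 2 = 1 then 1 else 0) = n % 2) ∧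
      ((if n % 2 = 0 then 1 else 0) = 1 - n % 2) := by
    intro n
    constructor <;> split_ifs <;> omega
  simp only [e1] at h
  omega

lemma exists_label {p : ℕ} [hp : Fact p.Prime] (hp17 : 17 < p) (v x : ZMod p × ZMod p) :
    ∃ n : ℕ, ∀ i < 5, x ≠ v → lab i x = lab i v → i = n := by
  by_cases h : conn x v
  · obtain ⟨n, hn, e⟩ := h
    refine ⟨n, fun i hi hne hl => ?_⟩
    by_contra hc
    exact hne (eq_of_lab hp17 i n hi hn hc _ _ hl e)
  · exact ⟨0, fun i hi _ hl => absurd ⟨i, hi, hl⟩ h⟩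

lemma lemmaK {p : ℕ} [NeZero p] [hp : Fact p.Prime] (hp17 : 17 < p)
    (S : Finset (ZMod p × ZMod p)) (hS : isAbsorbing (eabN p) S)
    (v x : ZMod p × ZMod p) (hv : v ∈ S) (m : ℕ) (hm : m < 5)
    (h : ∀ u ∈ S, u ≠ v → u = x ∨ lab m u = lab m v ∨ ¬ conn u v) : False := by
  obtain ⟨n, hn⟩ := exists_label hp17 v x
  obtain ⟨i, h1, h2, -, u, hu, huv, hl⟩ := three_even S hS v hv m n
  rcases h u hu huv with rfl | h3 | h3
  · exact h2 (hn i i.2 huv hl)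
  · exact huv (eq_of_lab hp17 i m i.2 hm h1 _ _ hl h3)
  · exact h3 ⟨i, i.2, hl⟩

lemma lemmaK2 {p : ℕ} [NeZero p] [hp : Fact p.Prime] (hp17 : 17 < p)
    (S : Finset (ZMod p × ZMod p)) (hS : isAbsorbing (eabN p) S)
    (v x y : ZMod p × ZMod p) (hv : v ∈ S) (m : Fin 5)
    (hodd : chkDeg (eabN p) S (m, lab (m : ℕ) v) % 2 = 1)
    (h : ∀ u ∈ S, u ≠ v → u = x ∨ u = y ∨ lab (m : ℕ) u = lab (m : ℕ) v ∨ ¬ conn u v) : False := by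
  obtain ⟨n, hn⟩ := exists_label hp17 v x
  obtain ⟨n', hn'⟩ := exists_label hp17 v y
  obtain ⟨i, h1, h2, h0, u, hu, huv, hl⟩ := three_even S hS v hv n n'
  have him : (i : ℕ) ≠ m := by
    intro hc
    have : i = m := Fin.ext hc
    subst this
    omega
  rcases h u hu huv with rfl | rfl | h3 | h3
  · exact h1 (hn i i.2 huv hl)
  · exact h2 (hn' i i.2 huv hl)
  · exact huv (eq_of_lab hp17 i m i.2 m.2 him _ _ hl h3)
  · exact h3 ⟨i, i.2, hl⟩

/-- The list of points enumerating the set. -/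
def Enum {p : ℕ} (S : Finset (ZMod p × ZMod p)) (C D E F A B : ZMod p × ZMod p) : Prop :=
  [C, D, E, F, A, B].Nodup ∧ S = [C, D, E, F, A, B].toFinset

lemma Enum.swap1 {p : ℕ} {S : Finset (ZMod p × ZMod p)} {C D E F A B : ZMod p × ZMod p}
    (h : Enum S C D E F A B) : Enum S D C E F A B := by
  have hp : List.Perm [C, D, E, F, A, B] [D, C, E, F, A, B] := List.Perm.swap _ _ _
  exact ⟨hp.nodup_iff.1 h.1, by rw [h.2]; exact List.toFinset_eq_of_perm _ _ hp⟩

lemma Enum.swap2 {p : ℕ} {S : Finset (ZMod p × ZMod p)} {C D E F A B : ZMod p × ZMod p}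
    (h : Enum S C D E F A B) : Enum S C E D F A B := by
  have hp : List.Perm [C, D, E, F, A, B] [C, E, D, F, A, B] :=
    List.Perm.cons _ (List.Perm.swap _ _ _)
  exact ⟨hp.nodup_iff.1 h.1, by rw [h.2]; exact List.toFinset_eq_of_perm _ _ hp⟩

lemma Enum.swap3 {p : ℕ} {S : Finset (ZMod p × ZMod p)} {C D E F A B : ZMod p × ZMod p}
    (h : Enum S C D E F A B) : Enum S C D F E A B := by
  have hp : List.Perm [C, D, E, F, A, B] [C, D, F, E, A, B] :=
    List.Perm.cons _ (List.Perm.cons _ (List.Perm.swap _ _ _))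
  exact ⟨hp.nodup_iff.1 h.1, by rw [h.2]; exact List.toFinset_eq_of_perm _ _ hp⟩

lemma Enum.swapPairs {p : ℕ} {S : Finset (ZMod p × ZMod p)} {C D E F A B : ZMod p × ZMod p}
    (h : Enum S C D E F A B) : Enum S E F C D A B :=
  h.swap2.swap1.swap3.swap2

/-- Base data: `A`, `B` joined in direction `m`, other nodes joined to both. -/
structure Base {p : ℕ} (m : ℕ) (O : ZMod p × ZMod p) (w : ZMod p) (A B : ZMod p × ZMod p) : Prop where
  hm : m < 5
  hw : w ≠ 0
  hA : A = place O w ptA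
  hB : B = place O w (ptB m)

lemma good_place {p : ℕ} [NeZero p] [hp : Fact p.Prime] (hp17 : 17 < p)
    {S : Finset (ZMod p × ZMod p)} (hS : isAbsorbing (eabN p) S)
    (h8 : (oddChecks (eabN p) S).card = 8) {m : ℕ} {O : ZMod p × ZMod p} {w : ZMod p}
    {A B : ZMod p × ZMod p} (hb : Base m O w A B) {C D E F : ZMod p × ZMod p}
    (hE : Enum S C D E F A B) {c d e f : ℕ × ℕ} (hc : c ∈ allPts m) (hd : d ∈ allPts m)
    (he : e ∈ allPts m) (hf : f ∈ allPts m) (hC : C = place O w c) (hD : D = place O w d)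
    (hE' : E = place O w e) (hF : F = place O w f) :
    goodPts (eN (qOf p)) [c, d, e, f, ptA, ptB m] = true := by
  have h1 := (good_iff _ hE.1).1 (by rw [← hE.2]; exact ⟨hS, h8⟩)
  rw [← goodPts_map (place O w) eF]
  · rw [← h1, hC, hD, hE', hF, hb.hA, hb.hB]
    rfl
  · have : ∀ x ∈ [c, d, e, f, ptA, ptB m], x ∈ allPts m := by
      intro x hx
      simp only [List.mem_cons, List.not_mem_nil, or_false] at hx
      rcases hx with rfl | rfl | rfl | rfl | rfl | rfl
      exacts [hc, hd, he, hf, mem_all_a, mem_all_b]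
    intro i hi x hx y hy
    exact eF_place hp17 m hb.hm O w hb.hw x y (this x hx) (this y hy) i hi

/-- The two final shapes. -/
def cfgA : List (ℕ × ℕ) := ptA :: ptB 2 :: shapeA

def cfgB : List (ℕ × ℕ) := ptA :: ptB 2 :: shapeB

lemma memN_spec (l : List (ℕ × ℕ)) (P : ℕ × ℕ) (h : memN l P = true) : P ∈ l := by
  unfold memN at h
  rw [List.any_eq_true] at h
  obtain ⟨R, hR, h⟩ := h
  simp only [Bool.and_eq_true, Nat.beq_eq] at h
  have : P = R := Prod.ext h.1 h.2
  exact this ▸ hR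

lemma Enum.ne {p : ℕ} {S : Finset (ZMod p × ZMod p)} {C D E F A B : ZMod p × ZMod p}
    (h : Enum S C D E F A B) : C ≠ D ∧ C ≠ E ∧ C ≠ F ∧ C ≠ A ∧ C ≠ B ∧ D ≠ E ∧ D ≠ F ∧ D ≠ A ∧
      D ≠ B ∧ E ≠ F ∧ E ≠ A ∧ E ≠ B ∧ F ≠ A ∧ F ≠ B ∧ A ≠ B := by
  have := h.1
  simp only [List.nodup_cons, List.mem_cons, List.not_mem_nil, or_false, not_or] at this
  tauto

lemma Enum.mem {p : ℕ} {S : Finset (ZMod p × ZMod p)} {C D E F A B : ZMod p × ZMod p}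
    (h : Enum S C D E F A B) (u : ZMod p × ZMod p) :
    u ∈ S ↔ u = C ∨ u = D ∨ u = E ∨ u = F ∨ u = A ∨ u = B := by
  rw [h.2]
  simp

lemma caseI_aux {p : ℕ} [NeZero p] [hp : Fact p.Prime] (hp17 : 17 < p)
    {S : Finset (ZMod p × ZMod p)} (hS : isAbsorbing (eabN p) S)
    (h8 : (oddChecks (eabN p) S).card = 8) {m : ℕ} {O : ZMod p × ZMod p} {w : ZMod p}
    {A B : ZMod p × ZMod p} (hb : Base m O w A B) {C D E F : ZMod p × ZMod p}
    (hE : Enum S C D E F A B) {c d e f : ℕ × ℕ} (hc : c ∈ qPts m) (hd : d ∈ qPts m)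
    (he : e ∈ qPts m) (hf : f ∈ qPts m) (hC : C = place O w c) (hD : D = place O w d)
    (hE' : E = place O w e) (hF : F = place O w f) (hCD : conn C D) (hEF : conn E F)
    (k1 : keyLe c d = true) (k2 : keyLe e f = true) (k3 : keyLe c e = true) :
    S = (cfgA.map (place O w)).toFinset ∨ S = (cfgB.map (place O w)).toFinset := by
  have hg := good_place hp17 hS h8 hb hE (mem_all_q hc) (mem_all_q hd) (mem_all_q he)
    (mem_all_q hf) hC hD hE' hF
  have hs := searchI_true _ (qOf_mem p) m hb.hm
  have hne := hE.ne
  have card : S.card = 6 := by rw [hE.2, List.toFinset_card_of_nodup hE.1]; rfl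
  have fin : ∀ L : List (ℕ × ℕ), L.length = 4 → m = 2 → (∀ x ∈ [c, d, e, f], x ∈ L) →
      S = ((ptA :: ptB 2 :: L).map (place O w)).toFinset := by
    rintro L hL rfl hx
    refine Finset.eq_of_subset_of_card_le ?_ ?_
    · intro u hu
      rw [hE.mem] at hu
      rw [List.mem_toFinset, List.mem_map]
      rcases hu with rfl | rfl | rfl | rfl | rfl | rfl
      · exact ⟨c, by simp [hx c (by simp)], hC.symm⟩
      · exact ⟨d, by simp [hx d (by simp)], hD.symm⟩
      · exact ⟨e, by simp [hx e (by simp)], hE'.symm⟩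
      · exact ⟨f, by simp [hx f (by simp)], hF.symm⟩
      · exact ⟨ptA, by simp, hb.hA.symm⟩
      · exact ⟨ptB 2, by simp, hb.hB.symm⟩
    · rw [card]
      refine (List.toFinset_card_le _).trans ?_
      simp [hL]
  have same : ∀ {X Y : ZMod p × ZMod p} {x y : ℕ × ℕ}, x ∈ qPts m → y ∈ qPts m →
      X = place O w x → Y = place O w y → X ≠ Y → sameN (qOf p) x y = false := by
    intro X Y x y hx hy h1 h2 h3
    rw [← Bool.not_eq_true, ← place_same hp17 m hb.hm O w hb.hw x y (mem_all_q hx) (mem_all_q hy),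
      ← h1, ← h2]
    exact h3
  have s1 := same hc hd hC hD hne.1
  have s2 := same hc he hC hE' hne.2.1
  have s3 := same hc hf hC hF hne.2.2.1
  have s4 := same hd he hD hE' hne.2.2.2.2.2.1
  have s5 := same hd hf hD hF hne.2.2.2.2.2.2.1
  have s6 := same he hf hE' hF hne.2.2.2.2.2.2.2.2.2.1
  have c1 := (place_conn hp17 m hb.hm O w hb.hw c d (mem_all_q hc) (mem_all_q hd)).1
    (by rw [← hC, ← hD]; exact hCD)
  have c2 := (place_conn hp17 m hb.hm O w hb.hw e f (mem_all_q he) (mem_all_q hf)).1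
    (by rw [← hE', ← hF]; exact hEF)
  unfold searchI at hs
  have hs := List.all_eq_true.1 (List.all_eq_true.1 hs c hc) d hd
  rw [k1, c1, s1] at hs
  have hs := List.all_eq_true.1 hs e he
  rw [k3, s2, s4] at hs
  have hs := List.all_eq_true.1 hs f hf
  rw [k2, c2, s3, s5, s6, hg] at hs
  simp only [Bool.not_true, Bool.false_or, Bool.and_eq_true, Bool.or_eq_true, Nat.beq_eq,
    List.all_eq_true] at hs
  obtain ⟨hm2, hs | hs⟩ := hs
  · exact Or.inl (fin shapeA rfl hm2 fun x hx => memN_spec _ _ (hs x hx))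
  · exact Or.inr (fin shapeB rfl hm2 fun x hx => memN_spec _ _ (hs x hx))

lemma keyLe_total (P R : ℕ × ℕ) : keyLe P R = true ∨ keyLe R P = true := by
  unfold keyLe
  rw [Nat.ble_eq, Nat.ble_eq]
  exact le_total _ _

lemma caseI {p : ℕ} [NeZero p] [hp : Fact p.Prime] (hp17 : 17 < p)
    {S : Finset (ZMod p × ZMod p)} (hS : isAbsorbing (eabN p) S)
    (h8 : (oddChecks (eabN p) S).card = 8) {m : ℕ} {O : ZMod p × ZMod p} {w : ZMod p}
    {A B : ZMod p × ZMod p} (hb : Base m O w A B) {C D E F : ZMod p × ZMod p}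
    (hE : Enum S C D E F A B) {c d e f : ℕ × ℕ} (hc : c ∈ qPts m) (hd : d ∈ qPts m)
    (he : e ∈ qPts m) (hf : f ∈ qPts m) (hC : C = place O w c) (hD : D = place O w d)
    (hE' : E = place O w e) (hF : F = place O w f) (hCD : conn C D) (hEF : conn E F) :
    S = (cfgA.map (place O w)).toFinset ∨ S = (cfgB.map (place O w)).toFinset := by
  have step1 : ∀ {C D E F : ZMod p × ZMod p}
      (_ : Enum S C D E F A B) {c d e f : ℕ × ℕ} (_ : c ∈ qPts m) (_ : d ∈ qPts m)
      (_ : e ∈ qPts m) (_ : f ∈ qPts m) (_ : C = place O w c) (_ : D = place O w d)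
      (_ : E = place O w e) (_ : F = place O w f) (_ : conn C D) (_ : conn E F)
      (_ : keyLe c d = true) (_ : keyLe e f = true),
      S = (cfgA.map (place O w)).toFinset ∨ S = (cfgB.map (place O w)).toFinset := by
    intro C D E F hE c d e f hc hd he hf hC hD hE' hF hCD hEF k1 k2
    rcases keyLe_total c e with k3 | k3
    · exact caseI_aux hp17 hS h8 hb hE hc hd he hf hC hD hE' hF hCD hEF k1 k2 k3
    · exact caseI_aux hp17 hS h8 hb hE.swapPairs he hf hc hd hE' hF hC hD hEF hCD k2 k1 k3
  rcases keyLe_total c d with k1 | k1 <;> rcases keyLe_total e f with k2 | k2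
  · exact step1 hE hc hd he hf hC hD hE' hF hCD hEF k1 k2
  · exact step1 hE.swap3 hc hd hf he hC hD hF hE' hCD (conn_symm hEF) k1 k2
  · exact step1 hE.swap1 hd hc he hf hD hC hE' hF (conn_symm hCD) hEF k1 k2
  · exact step1 hE.swap1.swap3 hd hc hf he hD hC hF hE' (conn_symm hCD) (conn_symm hEF) k1 k2

lemma caseII {p : ℕ} [NeZero p] [hp : Fact p.Prime] (hp17 : 17 < p)
    {S : Finset (ZMod p × ZMod p)} (hS : isAbsorbing (eabN p) S)
    (h8 : (oddChecks (eabN p) S).card = 8) {m : ℕ} {O : ZMod p × ZMod p} {w : ZMod p}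
    {A B : ZMod p × ZMod p} (hb : Base m O w A B) {C D E F : ZMod p × ZMod p}
    (hE : Enum S C D E F A B) {d e f : ℕ × ℕ} (hd : d ∈ qPts m)
    (he : e ∈ qPts m) (hf : f ∈ qPts m) (hD : D = place O w d)
    (hE' : E = place O w e) (hF : F = place O w f) (lC : lab m C = lab m A)
    (lD : lab m D ≠ lab m A) (lE : lab m E ≠ lab m A) (lF : lab m F ≠ lab m A) : False := by
  obtain ⟨nCD, nCE, nCF, nCA, nCB, nDE, nDF, nDA, nDB, nEF, nEA, nEB, nFA, nFB, nAB⟩ := hE.ne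
  have lB : lab m B = lab m A := by
    rw [hb.hA, hb.hB, lab_place, lab_place, (table_b m hb.hm).1]
  have hodd : chkDeg (eabN p) S (⟨m, hb.hm⟩, lab m C) = 3 := by
    unfold chkDeg
    have : (S.filter fun v => ((⟨m, hb.hm⟩, lab m C) : Fin 5 × ZMod p) ∈ eabN p v)
        = [C, A, B].toFinset := by
      ext u
      rw [Finset.mem_filter, hE.mem, mem_eabN]
      simp only [List.mem_toFinset, List.mem_cons, List.not_mem_nil, or_false, lC]
      constructor
      · rintro ⟨rfl | rfl | rfl | rfl | rfl | rfl, h⟩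
        · exact Or.inl rfl
        · exact absurd h lD
        · exact absurd h lE
        · exact absurd h lF
        · exact Or.inr (Or.inl rfl)
        · exact Or.inr (Or.inr rfl)
      · rintro (rfl | rfl | rfl)
        · exact ⟨Or.inl rfl, lC⟩
        · exact ⟨by simp, rfl⟩
        · exact ⟨by simp, lB⟩
    rw [this, List.toFinset_card_of_nodup (by simp [nCA, nCB, nAB])]
    rfl
  have hCS : C ∈ S := (hE.mem C).2 (Or.inl rfl)
  have K : ∀ x y : ZMod p × ZMod p, (∀ u ∈ S, u ≠ C → u = x ∨ u = y ∨ lab m u = lab m C ∨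
      ¬ conn u C) → False := fun x y h =>
    lemmaK2 hp17 S hS C x y hCS ⟨m, hb.hm⟩ (by simp only [hodd]) h
  have cD : conn C D := by
    by_contra hc
    apply K E F
    intro u hu huC
    rw [hE.mem] at hu
    rw [lC]
    rcases hu with rfl | rfl | rfl | rfl | rfl | rfl
    · exact absurd rfl huC
    · exact Or.inr (Or.inr (Or.inr fun h => hc (conn_symm h)))
    · exact Or.inl rfl
    · exact Or.inr (Or.inl rfl)
    · exact Or.inr (Or.inr (Or.inl rfl))
    · exact Or.inr (Or.inr (Or.inl lB))
  have cE : conn C E := by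
    by_contra hc
    apply K D F
    intro u hu huC
    rw [hE.mem] at hu
    rw [lC]
    rcases hu with rfl | rfl | rfl | rfl | rfl | rfl
    · exact absurd rfl huC
    · exact Or.inl rfl
    · exact Or.inr (Or.inr (Or.inr fun h => hc (conn_symm h)))
    · exact Or.inr (Or.inl rfl)
    · exact Or.inr (Or.inr (Or.inl rfl))
    · exact Or.inr (Or.inr (Or.inl lB))
  have cF : conn C F := by
    by_contra hc
    apply K D E
    intro u hu huC
    rw [hE.mem] at hu
    rw [lC]
    rcases hu with rfl | rfl | rfl | rfl | rfl | rfl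
    · exact absurd rfl huC
    · exact Or.inl rfl
    · exact Or.inr (Or.inl rfl)
    · exact Or.inr (Or.inr (Or.inr fun h => hc (conn_symm h)))
    · exact Or.inr (Or.inr (Or.inl rfl))
    · exact Or.inr (Or.inr (Or.inl lB))
  obtain ⟨c, hc, hC⟩ := on_line hp17 m hb.hm A B C D O w hb.hA hb.hB lC nCA nCB cD lD
    d hd hD
  have hg := good_place hp17 hS h8 hb hE (mem_all_l hc) (mem_all_q hd) (mem_all_q he)
    (mem_all_q hf) hC hD hE' hF
  have hs := searchII_true _ (qOf_mem p) m hb.hm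
  have same : ∀ {X Y : ZMod p × ZMod p} {x y : ℕ × ℕ}, x ∈ qPts m → y ∈ qPts m →
      X = place O w x → Y = place O w y → X ≠ Y → sameN (qOf p) x y = false := by
    intro X Y x y hx hy h1 h2 h3
    rw [← Bool.not_eq_true, ← place_same hp17 m hb.hm O w hb.hw x y (mem_all_q hx) (mem_all_q hy),
      ← h1, ← h2]
    exact h3
  have s4 := same hd he hD hE' nDE
  have s5 := same hd hf hD hF nDF
  have s6 := same he hf hE' hF nEF
  have c1 := (place_conn hp17 m hb.hm O w hb.hw c d (mem_all_l hc) (mem_all_q hd)).1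
    (by rw [← hC, ← hD]; exact cD)
  have c2 := (place_conn hp17 m hb.hm O w hb.hw c e (mem_all_l hc) (mem_all_q he)).1
    (by rw [← hC, ← hE']; exact cE)
  have c3 := (place_conn hp17 m hb.hm O w hb.hw c f (mem_all_l hc) (mem_all_q hf)).1
    (by rw [← hC, ← hF]; exact cF)
  unfold searchII at hs
  have hs := List.all_eq_true.1 (List.all_eq_true.1 hs c hc) d hd
  rw [c1] at hs
  have hs := List.all_eq_true.1 hs e he
  rw [c2, s4] at hs
  have hs := List.all_eq_true.1 hs f hf
  rw [c3, s5, s6, hg] at hs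
  simp at hs

lemma caseIII {p : ℕ} [NeZero p] [hp : Fact p.Prime] (hp17 : 17 < p)
    {S : Finset (ZMod p × ZMod p)} (hS : isAbsorbing (eabN p) S)
    (h8 : (oddChecks (eabN p) S).card = 8) {m : ℕ} {O : ZMod p × ZMod p} {w : ZMod p}
    {A B : ZMod p × ZMod p} (hb : Base m O w A B) {C D E F : ZMod p × ZMod p}
    (hE : Enum S C D E F A B) {e f : ℕ × ℕ}
    (he : e ∈ qPts m) (hf : f ∈ qPts m)
    (hE' : E = place O w e) (hF : F = place O w f) (lC : lab m C = lab m A)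
    (lD : lab m D = lab m A) (lE : lab m E ≠ lab m A) : False := by
  obtain ⟨nCD, nCE, nCF, nCA, nCB, nDE, nDF, nDA, nDB, nEF, nEA, nEB, nFA, nFB, nAB⟩ := hE.ne
  have lB : lab m B = lab m A := by
    rw [hb.hA, hb.hB, lab_place, lab_place, (table_b m hb.hm).1]
  have K : ∀ v x y : ZMod p × ZMod p, (v = C ∨ v = D) → (x = E ∧ y = F ∨ x = F ∧ y = E) →
      conn v x := by
    intro v x y hv hxy
    by_contra hc
    refine lemmaK hp17 S hS v y ((hE.mem v).2 (by tauto)) m hb.hm ?_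
    have lv : lab m v = lab m A := by rcases hv with rfl | rfl <;> assumption
    intro u hu huC
    rw [hE.mem] at hu
    rw [lv]
    have hc' : ¬ conn x v := fun h => hc (conn_symm h)
    rcases hu with rfl | rfl | rfl | rfl | rfl | rfl
    · exact Or.inr (Or.inl lC)
    · exact Or.inr (Or.inl lD)
    · rcases hxy with ⟨rfl, rfl⟩ | ⟨rfl, rfl⟩ <;> tauto
    · rcases hxy with ⟨rfl, rfl⟩ | ⟨rfl, rfl⟩ <;> tauto
    · exact Or.inr (Or.inl rfl)
    · exact Or.inr (Or.inl lB)
  have cCE : conn C E := K C E F (by tauto) (by tauto)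
  have cCF : conn C F := K C F E (by tauto) (by tauto)
  have cDE : conn D E := K D E F (by tauto) (by tauto)
  have cDF : conn D F := K D F E (by tauto) (by tauto)
  obtain ⟨c, hc, hC⟩ := on_line hp17 m hb.hm A B C E O w hb.hA hb.hB lC nCA nCB cCE lE
    e he hE'
  obtain ⟨d, hd, hD⟩ := on_line hp17 m hb.hm A B D E O w hb.hA hb.hB lD nDA nDB cDE lE
    e he hE'
  have hg := good_place hp17 hS h8 hb hE (mem_all_l hc) (mem_all_l hd) (mem_all_q he)
    (mem_all_q hf) hC hD hE' hF
  have hs := searchIII_true _ (qOf_mem p) m hb.hm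
  have same : ∀ {X Y : ZMod p × ZMod p} {x y : ℕ × ℕ}, x ∈ allPts m → y ∈ allPts m →
      X = place O w x → Y = place O w y → X ≠ Y → sameN (qOf p) x y = false := by
    intro X Y x y hx hy h1 h2 h3
    rw [← Bool.not_eq_true, ← place_same hp17 m hb.hm O w hb.hw x y hx hy, ← h1, ← h2]
    exact h3
  have s1 := same (mem_all_q he) (mem_all_q hf) hE' hF nEF
  have s2 := same (mem_all_l hc) (mem_all_l hd) hC hD nCD
  have c1 := (place_conn hp17 m hb.hm O w hb.hw c e (mem_all_l hc) (mem_all_q he)).1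
    (by rw [← hC, ← hE']; exact cCE)
  have c2 := (place_conn hp17 m hb.hm O w hb.hw c f (mem_all_l hc) (mem_all_q hf)).1
    (by rw [← hC, ← hF]; exact cCF)
  have c3 := (place_conn hp17 m hb.hm O w hb.hw d e (mem_all_l hd) (mem_all_q he)).1
    (by rw [← hD, ← hE']; exact cDE)
  have c4 := (place_conn hp17 m hb.hm O w hb.hw d f (mem_all_l hd) (mem_all_q hf)).1
    (by rw [← hD, ← hF]; exact cDF)
  unfold searchIII at hs
  have hs := List.all_eq_true.1 (List.all_eq_true.1 hs c hc) e he
  rw [c1] at hs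
  have hs := List.all_eq_true.1 hs f hf
  rw [c2, s1] at hs
  have hs := List.all_eq_true.1 hs d hd
  rw [c3, c4, s2, hg] at hs
  simp at hs

lemma caseV {p : ℕ} [NeZero p] [hp : Fact p.Prime] (hp17 : 17 < p)
    {S : Finset (ZMod p × ZMod p)} (hS : isAbsorbing (eabN p) S)
    {m : ℕ} {O : ZMod p × ZMod p} {w : ZMod p}
    {A B : ZMod p × ZMod p} (hb : Base m O w A B) {C D E F : ZMod p × ZMod p}
    (hE : Enum S C D E F A B) (lC : lab m C = lab m A)
    (lD : lab m D = lab m A) (lE : lab m E = lab m A) : False := by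
  have lB : lab m B = lab m A := by
    rw [hb.hA, hb.hB, lab_place, lab_place, (table_b m hb.hm).1]
  refine lemmaK hp17 S hS A F ((hE.mem A).2 (by tauto)) m hb.hm ?_
  intro u hu _
  rw [hE.mem] at hu
  rcases hu with rfl | rfl | rfl | rfl | rfl | rfl <;> tauto

lemma classify_aux {p : ℕ} [NeZero p] [hp : Fact p.Prime] (hp17 : 17 < p)
    {S : Finset (ZMod p × ZMod p)} (hS : isAbsorbing (eabN p) S)
    (h8 : (oddChecks (eabN p) S).card = 8) {C D E F A B : ZMod p × ZMod p}
    (hE : Enum S C D E F A B) (hAB : conn A B) (hCA : conn C A) (hDA : conn D A) (hEA : conn E A)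
    (hFA : conn F A) (hCB : conn C B) (hDB : conn D B) (hEB : conn E B)
    (hFB : conn F B) (hCD : conn C D) (hEF : conn E F) :
    ∃ O w, w ≠ 0 ∧
      (S = (cfgA.map (place O w)).toFinset ∨ S = (cfgB.map (place O w)).toFinset) := by
  obtain ⟨m, hm, hl⟩ := hAB
  have hne := hE.ne
  have hne' : A ≠ B := by tauto
  obtain ⟨O, w, hw, hA, hB⟩ := exists_base hp17 m hm A B hne' hl
  have hb : Base m O w A B := ⟨hm, hw, hA, hB⟩
  have off : ∀ X, conn X A → conn X B → lab m X ≠ lab m A → ∃ P ∈ qPts m, X = place O w P :=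
    fun X h1 h2 h3 => off_line hp17 m hm A B X O w hne' hA hB h1 h2 h3
  refine ⟨O, w, hw, ?_⟩
  have oC := off C hCA hCB
  have oD := off D hDA hDB
  have oE := off E hEA hEB
  have oF := off F hFA hFB
  by_cases lC : lab m C = lab m A <;> by_cases lD : lab m D = lab m A <;>
    by_cases lE : lab m E = lab m A <;> by_cases lF : lab m F = lab m A
  · exact (caseV hp17 hS hb hE lC lD lE).elim
  · exact (caseV hp17 hS hb hE lC lD lE).elim
  · exact (caseV hp17 hS hb hE.swap3 lC lD lF).elim
  · obtain ⟨e, he, hE'⟩ := oE lE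
    obtain ⟨f, hf, hF⟩ := oF lF
    exact (caseIII hp17 hS h8 hb hE he hf hE' hF lC lD lE).elim
  · exact (caseV hp17 hS hb hE.swap2.swap3 lC lE lF).elim
  · obtain ⟨d, hd, hD⟩ := oD lD
    obtain ⟨f, hf, hF⟩ := oF lF
    exact (caseIII hp17 hS h8 hb hE.swap2 hd hf hD hF lC lE lD).elim
  · obtain ⟨d, hd, hD⟩ := oD lD
    obtain ⟨e, he, hE'⟩ := oE lE
    exact (caseIII hp17 hS h8 hb hE.swap3.swap2 hd he hD hE' lC lF lD).elim
  · obtain ⟨d, hd, hD⟩ := oD lD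
    obtain ⟨e, he, hE'⟩ := oE lE
    obtain ⟨f, hf, hF⟩ := oF lF
    exact (caseII hp17 hS h8 hb hE hd he hf hD hE' hF lC lD lE lF).elim
  · exact (caseV hp17 hS hb hE.swap1.swap2.swap3 lD lE lF).elim
  · obtain ⟨c, hc, hC⟩ := oC lC
    obtain ⟨f, hf, hF⟩ := oF lF
    exact (caseIII hp17 hS h8 hb hE.swap1.swap2 hc hf hC hF lD lE lC).elim
  · obtain ⟨c, hc, hC⟩ := oC lC
    obtain ⟨e, he, hE'⟩ := oE lE
    exact (caseIII hp17 hS h8 hb hE.swap1.swap3.swap2 hc he hC hE' lD lF lC).elim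
  · obtain ⟨c, hc, hC⟩ := oC lC
    obtain ⟨e, he, hE'⟩ := oE lE
    obtain ⟨f, hf, hF⟩ := oF lF
    exact (caseII hp17 hS h8 hb hE.swap1 hc he hf hC hE' hF lD lC lE lF).elim
  · obtain ⟨c, hc, hC⟩ := oC lC
    obtain ⟨d, hd, hD⟩ := oD lD
    exact (caseIII hp17 hS h8 hb hE.swapPairs hc hd hC hD lE lF lC).elim
  · obtain ⟨c, hc, hC⟩ := oC lC
    obtain ⟨d, hd, hD⟩ := oD lD
    obtain ⟨f, hf, hF⟩ := oF lF
    exact (caseII hp17 hS h8 hb hE.swapPairs hf hc hd hF hC hD lE lF lC lD).elim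
  · obtain ⟨c, hc, hC⟩ := oC lC
    obtain ⟨d, hd, hD⟩ := oD lD
    obtain ⟨e, he, hE'⟩ := oE lE
    exact (caseII hp17 hS h8 hb hE.swapPairs.swap1 he hc hd hE' hC hD lF lE lC lD).elim
  · obtain ⟨c, hc, hC⟩ := oC lC
    obtain ⟨d, hd, hD⟩ := oD lD
    obtain ⟨e, he, hE'⟩ := oE lE
    obtain ⟨f, hf, hF⟩ := oF lF
    exact caseI hp17 hS h8 hb hE hc hd he hf hC hD hE' hF hCD hEF


/-- The properties defining the double-(4,8) configuration. -/
def isDouble {p : ℕ} [NeZero p] (S : Finset (ZMod p × ZMod p)) : Prop :=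
  S.card = 6 ∧ isAbsorbing (eabN p) S ∧ (oddChecks (eabN p) S).card = 8 ∧
      ∃ T1 T2 : Finset (ZMod p × ZMod p), T1 ⊆ S ∧ T2 ⊆ S ∧ T1.card = 4 ∧ T2.card = 4 ∧
        (T1 ∩ T2).card = 2 ∧ T1 ∪ T2 = S ∧ pairConn (eabN p) T1 ∧ pairConn (eabN p) T2

lemma classify {p : ℕ} [NeZero p] [hp : Fact p.Prime] (hp17 : 17 < p)
    {S : Finset (ZMod p × ZMod p)} (h : isDouble S) :
    ∃ O w, w ≠ 0 ∧
      (S = (cfgA.map (place O w)).toFinset ∨ S = (cfgB.map (place O w)).toFinset) := by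
  obtain ⟨h6, hS, h8, T1, T2, -, -, hc1, hc2, hi, hu, hp1, hp2⟩ := h
  have hs1 : (T1 \ T2).card = 2 := by
    have := Finset.card_sdiff_add_card_inter T1 T2
    omega
  have hs2 : (T2 \ T1).card = 2 := by
    have := Finset.card_sdiff_add_card_inter T2 T1
    rw [Finset.inter_comm] at this
    omega
  obtain ⟨A, B, hAB, hI⟩ := Finset.card_eq_two.1 hi
  obtain ⟨C, D, hCD, hX⟩ := Finset.card_eq_two.1 hs1
  obtain ⟨E, F, hEF, hY⟩ := Finset.card_eq_two.1 hs2
  have mI : ∀ v, (v ∈ T1 ∧ v ∈ T2) ↔ (v = A ∨ v = B) := fun v => by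
    rw [← Finset.mem_inter, hI]; simp
  have mX : ∀ v, (v ∈ T1 ∧ v ∉ T2) ↔ (v = C ∨ v = D) := fun v => by
    rw [← Finset.mem_sdiff, hX]; simp
  have mY : ∀ v, (v ∈ T2 ∧ v ∉ T1) ↔ (v = E ∨ v = F) := fun v => by
    rw [← Finset.mem_sdiff, hY]; simp
  obtain ⟨a1, a2⟩ := (mI A).2 (Or.inl rfl)
  obtain ⟨b1, b2⟩ := (mI B).2 (Or.inr rfl)
  obtain ⟨c1, c2⟩ := (mX C).2 (Or.inl rfl)
  obtain ⟨d1, d2⟩ := (mX D).2 (Or.inr rfl)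
  obtain ⟨e1, e2⟩ := (mY E).2 (Or.inl rfl)
  obtain ⟨f1, f2⟩ := (mY F).2 (Or.inr rfl)
  have ne1 : ∀ {T : Finset (ZMod p × ZMod p)} {u v}, u ∈ T → v ∉ T → u ≠ v :=
    fun hu hv h => hv (h ▸ hu)
  rw [pairConn_iff] at hp1 hp2
  have hE : Enum S C D E F A B := by
    refine ⟨?_, ?_⟩
    · have := ne1 c1 e2
      have := ne1 c1 f2
      have := (ne1 a2 c2).symm
      have := (ne1 b2 c2).symm
      have := ne1 d1 e2
      have := ne1 d1 f2
      have := (ne1 a2 d2).symm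
      have := (ne1 b2 d2).symm
      have := (ne1 a1 e2).symm
      have := (ne1 b1 e2).symm
      have := (ne1 a1 f2).symm
      have := (ne1 b1 f2).symm
      clear mI mX mY
      simp only [List.nodup_cons, List.mem_cons, List.not_mem_nil, or_false, not_or,
        List.nodup_nil, not_false_eq_true, and_true]
      refine ⟨⟨?_, ?_, ?_, ?_, ?_⟩, ⟨?_, ?_, ?_, ?_⟩, ⟨?_, ?_, ?_⟩, ⟨?_, ?_⟩, ?_⟩ <;> assumption
    · ext v
      rw [← hu, Finset.mem_union]
      simp only [List.mem_toFinset, List.mem_cons, List.not_mem_nil, or_false]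
      have h1 := mI v
      have h2 := mX v
      have h3 := mY v
      clear mI mX mY
      by_cases x1 : v ∈ T1 <;> by_cases x2 : v ∈ T2 <;>
        simp only [x1, x2, true_and, and_true, false_and, and_false, not_true_eq_false,
          not_false_eq_true, true_iff, false_iff, not_or] at h1 h2 h3 ⊢ <;> tauto
  obtain ⟨-, -, -, n1, n2, -, -, n3, n4, -, n5, n6, n7, n8, -⟩ := hE.ne
  exact classify_aux hp17 hS h8 hE (hp1 _ a1 _ b1 hAB) (hp1 _ c1 _ a1 n1)
    (hp1 _ d1 _ a1 n3) (hp2 _ e1 _ a2 n5) (hp2 _ f1 _ a2 n7)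
    (hp1 _ c1 _ b1 n2) (hp1 _ d1 _ b1 n4) (hp2 _ e1 _ b2 n6)
    (hp2 _ f1 _ b2 n8) (hp1 _ c1 _ d1 hCD) (hp2 _ e1 _ f1 hEF)

lemma cfg_sub : ∀ L ∈ [cfgA, cfgB], ∀ P ∈ L, P ∈ allPts 2 := by decide +kernel

lemma cfg_same : ∀ q ∈ [0, 19, 23, 73], ∀ L ∈ [cfgA, cfgB],
    L.Pairwise (fun P R => ¬ sameN q P R = true) := by decide +kernel

lemma cfg_good : ∀ q ∈ [0, 19, 23, 73], ∀ L ∈ [cfgA, cfgB], goodPts (eN q) L = true := by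
  decide +kernel

lemma cfg_conn : ∀ q ∈ [0, 19, 23, 73], ∀ L ∈ [cfgA, cfgB],
    (∀ P ∈ L.take 4, ∀ R ∈ L.take 4, connN q P R = true) ∧
    (∀ P ∈ L.take 2 ++ L.drop 4, ∀ R ∈ L.take 2 ++ L.drop 4, connN q P R = true) := by
  decide +kernel

lemma nodup_place {p : ℕ} [hp : Fact p.Prime] (hp17 : 17 < p) (L : List (ℕ × ℕ))
    (hL : L ∈ [cfgA, cfgB]) (O : ZMod p × ZMod p) (w : ZMod p) (hw : w ≠ 0) :
    (L.map (place O w)).Nodup := by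
  unfold List.Nodup
  rw [List.pairwise_map]
  refine List.Pairwise.imp_of_mem ?_ (cfg_same (qOf p) (qOf_mem p) L hL)
  intro P R hP hR h e
  exact h ((place_same hp17 2 (by norm_num) O w hw P R (cfg_sub L hL P hP)
    (cfg_sub L hL R hR)).1 e)

lemma isDouble_place {p : ℕ} [NeZero p] [hp : Fact p.Prime] (hp17 : 17 < p) (L : List (ℕ × ℕ))
    (hL : L ∈ [cfgA, cfgB]) (O : ZMod p × ZMod p) (w : ZMod p) (hw : w ≠ 0) :
    isDouble (L.map (place O w)).toFinset := by
  have hnd := nodup_place hp17 L hL O w hw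
  have hgood : goodPts eF (L.map (place O w)) = true := by
    rw [goodPts_map (place O w) eF (eN (qOf p)) L (fun i hi x hx y hy =>
      eF_place hp17 2 (by norm_num) O w hw x y (cfg_sub L hL x hx) (cfg_sub L hL y hy) i hi)]
    exact cfg_good _ (qOf_mem p) L hL
  obtain ⟨h1, h2⟩ := (good_iff _ hnd).2 hgood
  have hcn := cfg_conn _ (qOf_mem p) L hL
  have hpc : ∀ l : List (ℕ × ℕ), (∀ P ∈ l, P ∈ L) →
      (∀ P ∈ l, ∀ R ∈ l, connN (qOf p) P R = true) →
      pairConn (eabN p) (l.map (place O w)).toFinset := by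
    intro l hl hc
    rw [pairConn_iff]
    intro v hv u hu _
    simp only [List.mem_toFinset, List.mem_map] at hv hu
    obtain ⟨P, hP, rfl⟩ := hv
    obtain ⟨R, hR, rfl⟩ := hu
    exact (place_conn hp17 2 (by norm_num) O w hw P R (cfg_sub L hL P (hl P hP))
      (cfg_sub L hL R (hl R hR))).2 (hc P hP R hR)
  have hs1 : ∀ P ∈ L.take 4, P ∈ L := fun P hP => List.mem_of_mem_take hP
  have hs2 : ∀ P ∈ L.take 2 ++ L.drop 4, P ∈ L := fun P hP => by
    rcases List.mem_append.1 hP with h | h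
    · exact List.mem_of_mem_take h
    · exact List.mem_of_mem_drop h
  have hp1 := hpc _ hs1 hcn.1
  have hp2 := hpc _ hs2 hcn.2
  have hlen : ∃ a b c d e f, L = [a, b, c, d, e, f] := by
    simp only [List.mem_cons, List.not_mem_nil, or_false] at hL
    rcases hL with rfl | rfl
    · exact ⟨_, _, _, _, _, _, rfl⟩
    · exact ⟨_, _, _, _, _, _, rfl⟩
  obtain ⟨a, b, c, d, e, f, rfl⟩ := hlen
  refine ⟨?_, h1, h2, _, _, ?_, ?_, ?_, ?_, ?_, ?_, hp1, hp2⟩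
  · rw [List.toFinset_card_of_nodup hnd]; rfl
  · intro v hv
    simp only [List.mem_toFinset, List.mem_map] at hv ⊢
    obtain ⟨P, hP, rfl⟩ := hv
    exact ⟨P, hs1 P hP, rfl⟩
  · intro v hv
    simp only [List.mem_toFinset, List.mem_map] at hv ⊢
    obtain ⟨P, hP, rfl⟩ := hv
    exact ⟨P, hs2 P hP, rfl⟩
  all_goals
    simp only [List.map_cons, List.map_nil, List.take, List.drop, List.cons_append,
      List.nil_append] at hnd ⊢
    generalize place O w a = a' at *
    generalize place O w b = b' at *
    generalize place O w c = c' at *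
    generalize place O w d = d' at *
    generalize place O w e = e' at *
    generalize place O w f = f' at *
    clear hpc hp1 hp2 h1 h2 hgood hcn hs1 hs2
    simp only [List.nodup_cons, List.mem_cons, List.not_mem_nil, or_false, not_or,
        List.nodup_nil, not_false_eq_true, and_true] at hnd
    obtain ⟨⟨n1, n2, n3, n4, n5⟩, ⟨n6, n7, n8, n9⟩, ⟨n10, n11, n12⟩, ⟨n13, n14⟩, n15⟩ := hnd
  · rw [List.toFinset_card_of_nodup (by simp; tauto)]; rfl
  · rw [List.toFinset_card_of_nodup (by simp; tauto)]; rfl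
  · have : ([a', b', c', d'].toFinset ∩ [a', b', e', f'].toFinset) = [a', b'].toFinset := by
      ext v
      simp only [Finset.mem_inter, List.mem_toFinset, List.mem_cons, List.not_mem_nil, or_false]
      grind
    rw [this, List.toFinset_card_of_nodup (by simp; tauto)]; rfl
  · ext v
    simp only [Finset.mem_union, List.mem_toFinset, List.mem_cons, List.not_mem_nil, or_false]
    tauto

/-- Placement around the centre `z`. -/
def cfg {p : ℕ} (L : List (ℕ × ℕ)) (z : ZMod p × ZMod p) (w : ZMod p) :
    Finset (ZMod p × ZMod p) :=
  (L.map (place (z.1 - w * 6072, z.2 - w * 5856) w)).toFinset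

lemma cfg_of_place {p : ℕ} (L : List (ℕ × ℕ)) (O : ZMod p × ZMod p) (w : ZMod p) :
    (L.map (place O w)).toFinset = cfg L (O.1 + w * 6072, O.2 + w * 5856) w := by
  unfold cfg
  simp

lemma mem_cfg {p : ℕ} (L : List (ℕ × ℕ)) (z : ZMod p × ZMod p) (w : ZMod p)
    (v : ZMod p × ZMod p) : v ∈ cfg L z w ↔ ∃ P ∈ L, v = (z.1 + w * ((P.1 : ZMod p) - 6072),
      z.2 + w * ((P.2 : ZMod p) - 5856)) := by
  unfold cfg
  simp only [List.mem_toFinset, List.mem_map]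
  refine exists_congr fun P => and_congr_right fun _ => ?_
  have : place (z.1 - w * 6072, z.2 - w * 5856) w P = (z.1 + w * ((P.1 : ZMod p) - 6072),
      z.2 + w * ((P.2 : ZMod p) - 5856)) := by
    unfold place
    ext <;> simp <;> ring
  rw [this]
  exact eq_comm

lemma cfg_refl : ∀ L ∈ [cfgA, cfgB], ∀ P ∈ L, (12144 - P.1, 11712 - P.2) ∈ L ∧
    P.1 ≤ 12144 ∧ P.2 ≤ 11712 := by decide +kernel

lemma cfg_neg_sub {p : ℕ} (L : List (ℕ × ℕ)) (hL : L ∈ [cfgA, cfgB]) (z : ZMod p × ZMod p)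
    (w : ZMod p) : cfg L z (-w) ⊆ cfg L z w := by
  intro v hv
  rw [mem_cfg] at hv ⊢
  obtain ⟨P, hP, rfl⟩ := hv
  obtain ⟨h1, h2, h3⟩ := cfg_refl L hL P hP
  refine ⟨_, h1, ?_⟩
  rw [Nat.cast_sub h2, Nat.cast_sub h3]
  ext
  · push_cast; ring
  · push_cast; ring

lemma cfg_neg {p : ℕ} (L : List (ℕ × ℕ)) (hL : L ∈ [cfgA, cfgB]) (z : ZMod p × ZMod p)
    (w : ZMod p) : cfg L z (-w) = cfg L z w := by
  refine Finset.Subset.antisymm (cfg_neg_sub L hL z w) ?_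
  have := cfg_neg_sub L hL z (-w)
  rwa [neg_neg] at this

lemma small_ne {p : ℕ} [hp : Fact p.Prime] (hp17 : 17 < p) (n : ℕ) (h0 : 0 < n) (h1 : n ≤ 17) :
    (n : ZMod p) ≠ 0 := by
  intro h
  rw [ZMod.natCast_eq_zero_iff] at h
  have := Nat.le_of_dvd h0 h
  omega

lemma cfg_sum {p : ℕ} [hp : Fact p.Prime] (hp17 : 17 < p) (L : List (ℕ × ℕ))
    (hL : L ∈ [cfgA, cfgB]) (z : ZMod p × ZMod p) (w : ZMod p) (hw : w ≠ 0) :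
    ∑ v ∈ cfg L z w, v = (6 * z.1, 6 * z.2) := by
  unfold cfg
  rw [List.sum_toFinset _ (nodup_place hp17 L hL _ w hw)]
  simp only [List.mem_cons, List.not_mem_nil, or_false] at hL
  rcases hL with rfl | rfl
  · simp only [cfgA, shapeA, ptA, ptB, List.map_cons, List.map_nil, List.sum_cons,
      List.sum_nil, place]
    ext <;> simp <;> ring
  · simp only [cfgB, shapeB, ptA, ptB, List.map_cons, List.map_nil, List.sum_cons,
      List.sum_nil, place]
    ext <;> simp <;> ring

lemma centre_eq {p : ℕ} [hp : Fact p.Prime] (hp17 : 17 < p) (L L' : List (ℕ × ℕ))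
    (hL : L ∈ [cfgA, cfgB]) (hL' : L' ∈ [cfgA, cfgB]) (z z' : ZMod p × ZMod p) (w w' : ZMod p)
    (hw : w ≠ 0) (hw' : w' ≠ 0) (h : cfg L z w = cfg L' z' w') : z = z' := by
  have h1 := cfg_sum hp17 L hL z w hw
  rw [h, cfg_sum hp17 L' hL' z' w' hw'] at h1
  have h6 : (6 : ZMod p) ≠ 0 := by
    have := small_ne hp17 6 (by norm_num) (by norm_num)
    exact_mod_cast this
  have h2 := Prod.ext_iff.1 h1
  exact (Prod.ext (mul_left_cancel₀ h6 h2.1) (mul_left_cancel₀ h6 h2.2)).symm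

lemma scale_eq {p : ℕ} [hp : Fact p.Prime] (hp17 : 17 < p) (L L' : List (ℕ × ℕ))
    (hL : L ∈ [cfgA, cfgB]) (hL' : L' ∈ [cfgA, cfgB]) (z : ZMod p × ZMod p) (w w' : ZMod p)
    (hw' : w' ≠ 0) (h : cfg L z w = cfg L' z w') : w = w' ∨ w = -w' := by
  have h2 : (2 : ZMod p) ≠ 0 := by
    exact_mod_cast small_ne hp17 2 (by norm_num) (by norm_num)
  have h3 : (3 : ZMod p) ≠ 0 := by
    exact_mod_cast small_ne hp17 3 (by norm_num) (by norm_num)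
  have hm : ((z.1 + w * (((6000 : ℕ) : ZMod p) - 6072),
      z.2 + w * (((6000 : ℕ) : ZMod p) - 5856)) : ZMod p × ZMod p) ∈ cfg L z w := by
    rw [mem_cfg]
    refine ⟨(6000, 6000), ?_, rfl⟩
    simp only [List.mem_cons, List.not_mem_nil, or_false] at hL
    rcases hL with rfl | rfl <;> decide
  rw [h, mem_cfg] at hm
  obtain ⟨P, hP, he⟩ := hm
  obtain ⟨e1, e2⟩ := Prod.ext_iff.1 he
  simp only at e1 e2
  have n72 : (72 : ZMod p) ≠ 0 := by
    have : (72 : ZMod p) = 2 ^ 3 * 3 ^ 2 := by norm_num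
    rw [this]
    exact mul_ne_zero (pow_ne_zero _ h2) (pow_ne_zero _ h3)
  have n96 : (96 : ZMod p) ≠ 0 := by
    have : (96 : ZMod p) = 2 ^ 5 * 3 := by norm_num
    rw [this]
    exact mul_ne_zero (pow_ne_zero _ h2) h3
  have n288 : (288 : ZMod p) ≠ 0 := by
    have : (288 : ZMod p) = 96 * 3 := by norm_num
    rw [this]
    exact mul_ne_zero n96 h3
  have k1 : 72 * w = 72 * w' → w = w' ∨ w = -w' := fun h => Or.inl (mul_left_cancel₀ n72 h)
  have k2 : 72 * w = 72 * (-w') → w = w' ∨ w = -w' := fun h => Or.inr (mul_left_cancel₀ n72 h)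
  have k3 : 288 * w' = 0 → w = w' ∨ w = -w' := fun h => absurd h (mul_ne_zero n288 hw')
  have k4 : 96 * w' = 0 → w = w' ∨ w = -w' := fun h => absurd h (mul_ne_zero n96 hw')
  simp only [List.mem_cons, List.not_mem_nil, or_false] at hL'
  rcases hL' with rfl | rfl
  · simp only [cfgA, shapeA, ptA, ptB, List.mem_cons, List.not_mem_nil, or_false] at hP
    rcases hP with rfl | rfl | rfl | rfl | rfl | rfl <;> push_cast at e1 e2
    · exact k1 (by linear_combination -e1)
    · exact k2 (by linear_combination -e1)
    · exact k3 (by linear_combination e2 + 2 * e1)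
    · exact k3 (by linear_combination e2 + 2 * e1)
    · exact k3 (by linear_combination -(e2 + 2 * e1))
    · exact k3 (by linear_combination -(e2 + 2 * e1))
  · simp only [cfgB, shapeB, ptA, ptB, List.mem_cons, List.not_mem_nil, or_false] at hP
    rcases hP with rfl | rfl | rfl | rfl | rfl | rfl <;> push_cast at e1 e2
    · exact k1 (by linear_combination -e1)
    · exact k2 (by linear_combination -e1)
    · exact k4 (by linear_combination -(e2 + 2 * e1))
    · exact k4 (by linear_combination -(e2 + 2 * e1))
    · exact k4 (by linear_combination e2 + 2 * e1)
    · exact k4 (by linear_combination e2 + 2 * e1)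

lemma shape_ne {p : ℕ} [hp : Fact p.Prime] (hp17 : 17 < p) (z z' : ZMod p × ZMod p)
    (w w' : ZMod p) (hw : w ≠ 0) (hw' : w' ≠ 0) : cfg cfgA z w ≠ cfg cfgB z' w' := by
  intro h
  have hA : cfgA ∈ [cfgA, cfgB] := by simp
  have hB : cfgB ∈ [cfgA, cfgB] := by simp
  have hz := centre_eq hp17 _ _ hA hB z z' w w' hw hw' h
  subst hz
  have h1 : cfg cfgA z w = cfg cfgB z w := by
    rcases scale_eq hp17 _ _ hA hB z w w' hw' h with rfl | rfl
    · exact h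
    · rw [h, cfg_neg _ hB]
  have h2 : (2 : ZMod p) ≠ 0 := by
    exact_mod_cast small_ne hp17 2 (by norm_num) (by norm_num)
  have h3 : (3 : ZMod p) ≠ 0 := by
    exact_mod_cast small_ne hp17 3 (by norm_num) (by norm_num)
  have h5 : (5 : ZMod p) ≠ 0 := by
    exact_mod_cast small_ne hp17 5 (by norm_num) (by norm_num)
  have hm : ((z.1 + w * (((6288 : ℕ) : ZMod p) - 6072),
      z.2 + w * (((5136 : ℕ) : ZMod p) - 5856)) : ZMod p × ZMod p) ∈ cfg cfgA z w := by
    rw [mem_cfg]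
    exact ⟨(6288, 5136), by decide, rfl⟩
  rw [h1, mem_cfg] at hm
  obtain ⟨P, hP, he⟩ := hm
  obtain ⟨e1, e2⟩ := Prod.ext_iff.1 he
  simp only at e1 e2
  have hK : ∀ a b c : ℕ, (2 ^ a * 3 ^ b * 5 ^ c : ZMod p) * w ≠ 0 := fun a b c =>
    mul_ne_zero (mul_ne_zero (mul_ne_zero (pow_ne_zero _ h2) (pow_ne_zero _ h3))
      (pow_ne_zero _ h5)) hw
  have k1 : 288 * w = 0 → False := fun h => hK 5 2 0 (by linear_combination h)
  have k2 : 192 * w = 0 → False := fun h => hK 6 1 0 (by linear_combination h)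
  have k3 : 240 * w = 0 → False := fun h => hK 4 1 1 (by linear_combination h)
  simp only [cfgB, shapeB, ptA, ptB, List.mem_cons, List.not_mem_nil, or_false] at hP
  rcases hP with rfl | rfl | rfl | rfl | rfl | rfl <;> push_cast at e1 e2
  · exact k1 (by linear_combination -(e2 + 2 * e1))
  · exact k1 (by linear_combination -(e2 + 2 * e1))
  · exact k3 (by linear_combination e1)
  · exact k2 (by linear_combination e1)
  · exact k2 (by linear_combination e1)
  · exact k3 (by linear_combination e1)

/-- Shape chosen by the half in which the unit lies. -/
def shapeOf {p : ℕ} (w : ZMod p) : List (ℕ × ℕ) := if w.val * 2 < p then cfgA else cfgB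

lemma shapeOf_mem {p : ℕ} (w : ZMod p) : shapeOf w ∈ [cfgA, cfgB] := by
  unfold shapeOf
  split_ifs <;> simp

lemma half_neg {p : ℕ} [NeZero p] [hp : Fact p.Prime] (hp17 : 17 < p) (w : ZMod p)
    (hw : w ≠ 0) : (-w).val * 2 < p ↔ ¬ w.val * 2 < p := by
  haveI : NeZero w := ⟨hw⟩
  rw [ZMod.val_neg_of_ne_zero]
  have := w.val_lt
  have ho : p % 2 = 1 := by
    rcases hp.out.eq_two_or_odd with h | h
    · omega
    · exact h
  omega

lemma count_aux {p : ℕ} [NeZero p] [hp : Fact p.Prime] (hp17 : 17 < p) :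
    Nat.card {S : Finset (ZMod p × ZMod p) // isDouble S} = p ^ 2 * (p - 1) := by
  have hA : cfgA ∈ [cfgA, cfgB] := by simp
  have hB : cfgB ∈ [cfgA, cfgB] := by simp
  let f : (ZMod p × ZMod p) × (ZMod p)ˣ → {S : Finset (ZMod p × ZMod p) // isDouble S} :=
    fun x => ⟨cfg (shapeOf (x.2 : ZMod p)) x.1 x.2,
      isDouble_place hp17 _ (shapeOf_mem _) _ _ x.2.ne_zero⟩
  have hf : Function.Bijective f := by
    constructor
    · rintro ⟨z, w⟩ ⟨z', w'⟩ h
      have h : cfg (shapeOf (w : ZMod p)) z w = cfg (shapeOf (w' : ZMod p)) z' w' :=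
        congrArg Subtype.val h
      have hz := centre_eq hp17 _ _ (shapeOf_mem _) (shapeOf_mem _) z z' w w' w.ne_zero
        w'.ne_zero h
      subst hz
      rcases scale_eq hp17 _ _ (shapeOf_mem _) (shapeOf_mem _) z w w' w'.ne_zero h with e | e
      · rw [Units.ext e]
      · exfalso
        have hh := half_neg hp17 (w' : ZMod p) w'.ne_zero
        rw [← e] at hh
        unfold shapeOf at h
        by_cases hc : (w' : ZMod p).val * 2 < p
        · rw [if_neg (fun h => hh.1 h hc), if_pos hc] at h
          exact shape_ne hp17 _ _ _ _ w'.ne_zero w.ne_zero h.symm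
        · rw [if_pos (hh.2 hc), if_neg hc] at h
          exact shape_ne hp17 _ _ _ _ w.ne_zero w'.ne_zero h
    · rintro ⟨S, hS⟩
      obtain ⟨O, w, hw, h⟩ := classify hp17 hS
      have hh := half_neg hp17 w hw
      rw [cfg_of_place, cfg_of_place] at h
      rcases h with h | h
      · by_cases hc : w.val * 2 < p
        · refine ⟨((O.1 + w * 6072, O.2 + w * 5856), Units.mk0 w hw), Subtype.ext ?_⟩
          · change cfg (shapeOf w) _ w = S
            rw [h, shapeOf, if_pos hc]
        · refine ⟨((O.1 + w * 6072, O.2 + w * 5856), Units.mk0 (-w) (neg_ne_zero.2 hw)), Subtype.ext ?_⟩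
          · change cfg (shapeOf (-w)) _ (-w) = S
            rw [h, shapeOf, if_pos (hh.2 hc), cfg_neg _ hA]
      · by_cases hc : w.val * 2 < p
        · refine ⟨((O.1 + w * 6072, O.2 + w * 5856), Units.mk0 (-w) (neg_ne_zero.2 hw)), Subtype.ext ?_⟩
          · change cfg (shapeOf (-w)) _ (-w) = S
            rw [h, shapeOf, if_neg (fun h => hh.1 h hc), cfg_neg _ hB]
        · refine ⟨((O.1 + w * 6072, O.2 + w * 5856), Units.mk0 w hw), Subtype.ext ?_⟩
          · change cfg (shapeOf w) _ w = S
            rw [h, shapeOf, if_neg hc]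
  rw [← Nat.card_eq_of_bijective f hf, Nat.card_prod, Nat.card_prod, Nat.card_zmod,
    Nat.card_eq_fintype_card, ZMod.card_units, sq]

/-- For a prime `p > 17`, the number of (6,8) absorbing sets of the
double-(4,8) configuration in the `r = 5` EAB code is exactly `p²(p-1)`. -/
theorem eab_68_double48_count (p : ℕ) [NeZero p] (hp : p.Prime) (hp17 : 17 < p) :
    Nat.card {S : Finset (ZMod p × ZMod p) //
      S.card = 6 ∧ isAbsorbing (eabN p) S ∧ (oddChecks (eabN p) S).card = 8 ∧
      ∃ T1 T2 : Finset (ZMod p × ZMod p), T1 ⊆ S ∧ T2 ⊆ S ∧ T1.card = 4 ∧ T2.card = 4 ∧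
        (T1 ∩ T2).card = 2 ∧ T1 ∪ T2 = S ∧ pairConn (eabN p) T1 ∧ pairConn (eabN p) T2} =
    p ^ 2 * (p - 1) := by 
  haveI : Fact p.Prime := ⟨hp⟩
  exact count_aux hp17
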